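/- arXiv:2403.00294 — 3 statements merged into one kernel-verified Lean document; each statement's English description precedes it below -/
import Mathlib

section
/- (Theorem 1) Under Assumption 1, for every t ∈ [0,1] the map φ(·,t) defined by φ(x,t) = x − h(x,t) has a fixed point lying in int(X); equivalently, for every t ∈ [0,1] there exists x ∈ int(X) with h(x,t) = 0. -/
open Real Set RealInnerProductSpace

section NoRetraction

variable {E : Type*} [NormedAddCommGroup E]

/-- The determinant of `1 + t • A` is a polynomial in `t` of degree at most the dimension. -/
lemma exists_polynomial_eval_eq_det_one_add_smul [NormedSpace ℝ E] [FiniteDimensional ℝ E]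
    (A : E →L[ℝ] E) :
    ∃ p : Polynomial ℝ, p.natDegree ≤ Module.finrank ℝ E ∧
      ∀ t : ℝ, p.eval t = (1 + t • A).det := by
  let b := Module.finBasis ℝ E
  let M : Matrix (Fin (Module.finrank ℝ E)) (Fin (Module.finrank ℝ E)) ℝ :=
    LinearMap.toMatrix b b (A : E →ₗ[ℝ] E)
  let I : Matrix (Fin (Module.finrank ℝ E)) (Fin (Module.finrank ℝ E)) ℝ := 1
  refine ⟨((Polynomial.X : Polynomial ℝ) • M.map (Polynomial.C : ℝ →+* Polynomial ℝ) +
    I.map (Polynomial.C : ℝ →+* Polynomial ℝ)).det, ?_, ?_⟩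
  · simpa using Polynomial.natDegree_det_X_add_C_le M I
  · intro t
    rw [← Polynomial.coe_evalRingHom, RingHom.map_det, ContinuousLinearMap.det,
      ← LinearMap.det_toMatrix b]
    congr 1
    have : LinearMap.toMatrix b b ((1 + t • A : E →L[ℝ] E) : E →ₗ[ℝ] E) = 1 + t • M := by
      rw [← LinearMap.toMatrix_one b]
      simp only [M, ← map_smul, ← map_add]
      rfl
    rw [this]
    ext i j
    simp [I, add_comm, Matrix.one_apply, apply_ite]
    exact mul_comm _ _

/-- Extending by zero outside a ball preserves Lipschitz continuity of a map vanishing on the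
sphere. -/
lemma LipschitzOnWith.lipschitzWith_indicator_ball [NormedSpace ℝ E] {u : E → E} {K : NNReal}
    {R : ℝ} (hu : LipschitzOnWith K u (Metric.closedBall 0 R)) (h0 : ∀ x, ‖x‖ = R → u x = 0) :
    LipschitzWith K ((Metric.ball 0 R).indicator u) := by
  have key : ∀ x y : E, x ∈ Metric.ball (0 : E) R → y ∉ Metric.ball (0 : E) R →
      ‖u x‖ ≤ K * ‖x - y‖ := by
    intro x y hx hy
    simp only [Metric.mem_ball, dist_zero_right, not_lt] at hx hy
    have hc : ContinuousOn (fun s : ℝ => ‖x + s • (y - x)‖) (Icc 0 1) := by fun_prop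
    obtain ⟨s, hs, hsR⟩ := intermediate_value_Icc zero_le_one hc
      (show R ∈ Icc _ _ by simpa using ⟨hx.le, hy⟩)
    have h1 := hu.norm_sub_le (x := x) (by simpa using hx.le)
      (y := x + s • (y - x)) (by simpa using hsR.le)
    rw [h0 _ hsR, sub_zero, sub_add_cancel_left, norm_neg, norm_smul, Real.norm_of_nonneg hs.1,
      norm_sub_rev y x] at h1
    exact h1.trans (mul_le_mul_of_nonneg_left (mul_le_of_le_one_left (norm_nonneg _) hs.2) K.2)
  refine LipschitzWith.of_dist_le_mul fun x y => ?_
  rw [dist_eq_norm, dist_eq_norm]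
  by_cases hx : x ∈ Metric.ball (0 : E) R <;> by_cases hy : y ∈ Metric.ball (0 : E) R
  · simp only [hx, hy, indicator_of_mem]
    exact hu.norm_sub_le (Metric.ball_subset_closedBall hx) (Metric.ball_subset_closedBall hy)
  · simpa [hx, hy] using key x y hx hy
  · simpa [hx, hy, norm_sub_rev] using key y x hy hx
  · simp only [hx, hy, not_false_eq_true, indicator_of_notMem, sub_self, norm_zero]
    positivity

/-- A contractive perturbation of the identity supported in a set permutes that set. -/
lemma bijOn_add_of_contracting [CompleteSpace E] {v : E → E} {K : NNReal} (hK : K < 1)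
    (hv : LipschitzWith K v) {B : Set E} (hB : ∀ x ∉ B, v x = 0) :
    BijOn (fun x => x + v x) B B := by
  have hinj : Function.Injective fun x => x + v x := by
    intro x y hxy
    have h1 := hv.norm_sub_le x y
    have h2 : v x - v y = -(x - y) := by
      have : x + v x = y + v y := hxy
      rw [neg_sub, sub_eq_sub_iff_add_eq_add, add_comm, this]
    rw [h2, norm_neg] at h1
    have h3 : (K : ℝ) < 1 := hK
    have : ‖x - y‖ = 0 := by nlinarith [norm_nonneg (x - y)]
    exact sub_eq_zero.1 (norm_eq_zero.1 this)
  refine ⟨fun x hx => ?_, hinj.injOn, fun y hy => ?_⟩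
  · by_contra h
    have : x + v x = x := hinj (by simp [hB _ h])
    exact h (by simpa [this] using hx)
  · have hc : ContractingWith K fun x => y - v x := by
      refine ⟨hK, LipschitzWith.of_dist_le_mul fun a b => ?_⟩
      rw [dist_sub_left]
      exact hv.dist_le_mul a b
    have hfix := hc.fixedPoint_isFixedPt
    set z := ContractingWith.fixedPoint _ hc
    have hz : z + v z = y := by
      have : y - v z = z := hfix
      exact eq_add_of_sub_eq this |>.symm
    refine ⟨z, ?_, hz⟩
    by_contra h
    rw [hB z h, add_zero] at hz
    exact h (hz ▸ hy)

/-- A differentiable map of constant nonzero norm has singular derivative. -/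
lemma det_fderiv_eq_zero_of_norm_eq [InnerProductSpace ℝ E] [FiniteDimensional ℝ E] {r : E → E}
    (hr : Differentiable ℝ r) {R : ℝ} (hR : 0 < R) (hn : ∀ x, ‖r x‖ = R) (x : E) :
    (fderiv ℝ r x).det = 0 := by
  by_contra h
  have horth : ∀ w, ⟪r x, fderiv ℝ r x w⟫ = 0 := by
    intro w
    have h1 := ((hr x).hasFDerivAt.norm_sq).unique
      ((hasFDerivAt_const (R ^ 2) x).congr_of_eventuallyEq
        (Filter.Eventually.of_forall fun y => by simp [hn]))
    have h2 := congrArg (fun T => T w) h1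
    simpa using h2
  obtain ⟨w, hw⟩ := (LinearMap.equivOfDetNeZero (fderiv ℝ r x : E →ₗ[ℝ] E) h).surjective (r x)
  have hw' : fderiv ℝ r x w = r x := hw
  have := horth w
  rw [hw', real_inner_self_eq_norm_sq, hn] at this
  exact hR.ne' (by simpa using this)

variable [InnerProductSpace ℝ E] [FiniteDimensional ℝ E]

open MeasureTheory in
/-- Perturbing the identity on a ball by a small multiple of a `C¹` field vanishing on the sphere
preserves volume. -/
lemma exists_forall_integral_det_one_add_smul_eq [MeasurableSpace E] [BorelSpace E]
    {u : E → E} (hu : ContDiff ℝ 1 u) {R : ℝ} (h0 : ∀ x, ‖x‖ = R → u x = 0) :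
    ∃ ε > (0 : ℝ), ∀ t ∈ Ioo 0 ε, ∫ x in Metric.ball (0 : E) R, (1 + t • fderiv ℝ u x).det
      = volume.real (Metric.ball (0 : E) R) := by
  obtain ⟨K, hK⟩ := hu.contDiffOn.exists_lipschitzOnWith one_ne_zero
    (convex_closedBall (0 : E) R) (isCompact_closedBall 0 R)
  have hKv := hK.lipschitzWith_indicator_ball h0
  have hfd : ∀ x ∈ Metric.ball (0 : E) R, ‖fderiv ℝ u x‖ ≤ K := fun x hx =>
    norm_fderiv_le_of_lipschitzOn ℝ
      (Filter.mem_of_superset (Metric.isOpen_ball.mem_nhds hx) Metric.ball_subset_closedBall) hK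
  have hpos : ∀ᶠ A : E →L[ℝ] E in nhds 0, 0 < (1 + A).det := by
    have hc : Continuous fun A : E →L[ℝ] E => (1 + A).det :=
      ContinuousLinearMap.continuous_det.comp (continuous_const.add continuous_id)
    refine hc.continuousAt.eventually (lt_mem_nhds ?_)
    simp [ContinuousLinearMap.det]
  obtain ⟨δ, hδ, hδpos⟩ := Metric.eventually_nhds_iff.1 hpos
  refine ⟨min 1 δ / (K + 1), by positivity, fun t ht => ?_⟩
  have htK : t * K < min 1 δ := by
    have := (lt_div_iff₀ (by positivity)).1 ht.2
    nlinarith [ht.1]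
  have hdet : ∀ x ∈ Metric.ball (0 : E) R, 0 < (1 + t • fderiv ℝ u x).det := by
    intro x hx
    apply hδpos
    rw [dist_zero_right, norm_smul, Real.norm_of_nonneg ht.1.le]
    exact ((mul_le_mul_of_nonneg_left (hfd x hx) ht.1.le).trans_lt htK).trans_le (min_le_right _ _)
  have hbij : BijOn (fun x => x + t • (Metric.ball (0 : E) R).indicator u x)
      (Metric.ball 0 R) (Metric.ball 0 R) := by
    refine bijOn_add_of_contracting (K := ⟨t, ht.1.le⟩ * K) ?_ ?_ ?_
    · exact htK.trans_le (min_le_left _ _)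
    · refine LipschitzWith.of_dist_le_mul fun x y => ?_
      rw [dist_smul₀, Real.norm_of_nonneg ht.1.le]
      change _ ≤ t * K * _
      rw [mul_assoc]
      exact mul_le_mul_of_nonneg_left (hKv.dist_le_mul x y) ht.1.le
    · intro x hx
      simp [hx]
  have hbij' : BijOn (fun x => x + t • u x) (Metric.ball 0 R) (Metric.ball 0 R) :=
    hbij.congr fun x hx => by simp only [indicator_of_mem hx]
  have hcv := integral_image_eq_integral_abs_det_fderiv_smul (volume : Measure E)
    (f := fun x => x + t • u x) (f' := fun x => 1 + t • fderiv ℝ u x)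
    (measurableSet_ball (x := (0 : E)) (ε := R))
    (fun x _ => ((hasFDerivAt_id x).add
      (((hu.differentiable one_ne_zero) x).hasFDerivAt.const_smul t)).hasFDerivWithinAt)
    hbij'.injOn (fun _ => (1 : ℝ))
  rw [hbij'.image_eq] at hcv
  rw [setIntegral_congr_fun measurableSet_ball
    (g := fun x => |(1 + t • fderiv ℝ u x).det| • (1 : ℝ))
    (fun x hx => by simp [abs_of_pos (hdet x hx)]), ← hcv]
  simp

open MeasureTheory in
/-- There is no `C¹` retraction onto a sphere. -/
theorem not_contDiff_retraction_sphere {r : E → E} (hr : ContDiff ℝ 1 r) {R : ℝ} (hR : 0 < R)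
    (hn : ∀ x, ‖r x‖ = R) (hid : ∀ x, ‖x‖ = R → r x = x) : False := by
  borelize E
  have hu : ContDiff ℝ 1 fun x => r x - x := hr.sub contDiff_id
  obtain ⟨ε, hε, hvol⟩ := exists_forall_integral_det_one_add_smul_eq hu
    (R := R) fun x hx => by simp [hid x hx]
  obtain ⟨s, hs, hcard⟩ := (Ioo_infinite hε).exists_subset_card_eq (Module.finrank ℝ E + 1)
  have hinj : InjOn (id : ℝ → ℝ) s := injOn_id _
  have hlag : ∀ x, ∑ t ∈ s, (1 + t • fderiv ℝ (fun x => r x - x) x).det *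
      (Lagrange.basis s id t).eval 1 = 0 := by
    intro x
    obtain ⟨p, hp, hpe⟩ :=
      exists_polynomial_eval_eq_det_one_add_smul (fderiv ℝ (fun x => r x - x) x)
    have hdeg : p.degree < s.card := by
      refine Polynomial.degree_le_natDegree.trans_lt ?_
      rw [hcard]
      exact_mod_cast Nat.lt_succ_of_le hp
    have h1 := congrArg (Polynomial.eval 1) (Lagrange.eq_interpolate hinj hdeg)
    rw [Lagrange.interpolate_apply, Polynomial.eval_finsetSum, hpe] at h1
    simp only [Polynomial.eval_mul, Polynomial.eval_C, id, hpe] at h1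
    have hd : (1 : E →L[ℝ] E) + (1 : ℝ) • fderiv ℝ (fun x => r x - x) x = fderiv ℝ r x := by
      rw [fderiv_fun_sub (hr.differentiable one_ne_zero x) differentiableAt_fun_id, fderiv_fun_id,
        one_smul]
      exact add_sub_cancel _ _
    rw [hd, det_fderiv_eq_zero_of_norm_eq (hr.differentiable one_ne_zero) hR hn] at h1
    exact h1.symm
  have hint : ∀ t ∈ s, IntegrableOn (fun x => (1 + t • fderiv ℝ (fun x => r x - x) x).det *
      (Lagrange.basis s id t).eval 1) (Metric.ball (0 : E) R) := by
    intro t _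
    have hc : Continuous fun x => (1 + t • fderiv ℝ (fun x => r x - x) x).det *
        (Lagrange.basis s id t).eval 1 :=
      (ContinuousLinearMap.continuous_det.comp (continuous_const.add
        ((hu.continuous_fderiv one_ne_zero).const_smul t))).mul continuous_const
    exact (hc.continuousOn.integrableOn_compact (isCompact_closedBall 0 R)).mono_set
      Metric.ball_subset_closedBall
  have hsum := integral_finsetSum s hint
  simp only [hlag, integral_zero, integral_mul_const] at hsum
  rw [Finset.sum_congr rfl fun t ht => by rw [hvol t (hs ht)], ← Finset.mul_sum,
    ← Polynomial.eval_finsetSum, Lagrange.sum_basis hinj (Finset.card_pos.1 (by omega)),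
    Polynomial.eval_one, mul_one] at hsum
  exact (ENNReal.toReal_pos (Metric.measure_ball_pos volume (0 : E) hR).ne'
    measure_ball_lt_top.ne).ne hsum

/-- A `C¹` vector field pointing outward outside a ball has a zero. -/
theorem exists_eq_zero_of_inner_pos {g : E → E} (hg : ContDiff ℝ 1 g) {R : ℝ} (hR : 0 < R)
    (x₀ : E) (hpos : ∀ x, R ≤ ‖x - x₀‖ → 0 < ⟪x - x₀, g x⟫) : ∃ x, g x = 0 := by
  by_contra! hne
  let χ : ContDiffBump (0 : E) := ⟨R, 2 * R, hR, by linarith⟩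
  let G : E → E := fun x => χ x • g (x + x₀) + (1 - χ x) • x
  have hG : ContDiff ℝ 1 G := by
    have hχ : ContDiff ℝ 1 χ := χ.contDiff
    have : ContDiff ℝ 1 fun x => g (x + x₀) := hg.comp (contDiff_id.add contDiff_const)
    exact (hχ.smul this).add ((contDiff_const.sub hχ).smul contDiff_id)
  have hG0 : ∀ x, G x ≠ 0 := by
    intro x hx
    rcases le_total ‖x‖ R with hxR | hxR
    · have : χ x = 1 := χ.one_of_mem_closedBall (by simpa using hxR)
      simp only [G, this, one_smul, sub_self, zero_smul, add_zero] at hx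
      exact hne _ hx
    · have h1 := hpos (x + x₀) (by simpa using hxR)
      rw [add_sub_cancel_right] at h1
      have h2 : ⟪x, G x⟫ = χ x * ⟪x, g (x + x₀)⟫ + (1 - χ x) * ‖x‖ ^ 2 := by
        simp only [G, inner_add_right, real_inner_smul_right, real_inner_self_eq_norm_sq]
      rw [hx, inner_zero_right] at h2
      have h3 : 0 < ‖x‖ ^ 2 := by have := hR.trans_le hxR; positivity
      have h4 := χ.nonneg (x := x)
      have h5 := χ.le_one (x := x)
      rcases h4.eq_or_lt with h | h
      · rw [← h] at h2; linarith
      · nlinarith [mul_pos h h1, mul_nonneg (sub_nonneg.2 h5) h3.le]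
  have hGn : ∀ x, ‖G x‖ ≠ 0 := fun x => norm_ne_zero_iff.2 (hG0 x)
  refine not_contDiff_retraction_sphere (r := fun x => (2 * R * ‖G x‖⁻¹) • G x) (R := 2 * R)
    ((contDiff_const.mul ((hG.norm ℝ hG0).inv hGn)).smul hG) (by positivity) (fun x => ?_)
    fun x hx => ?_
  · rw [norm_smul, Real.norm_of_nonneg (by positivity), mul_assoc, inv_mul_cancel₀ (hGn x), mul_one]
  · have hχ : χ x = 0 := χ.zero_of_le_dist (by simpa using hx.ge)
    have hGx : G x = x := by simp [G, hχ]
    rw [hGx, hx, mul_inv_cancel₀ (by positivity), one_smul]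

end NoRetraction

/-- Theorem 1: Under Assumption 1, for every t ∈ [0,1] the map
φ(·,t) = x − h(x,t) has a fixed point lying in int(X); equivalently, for every t ∈ [0,1]
there exists x ∈ int(X) with h(x,t) = 0. -/
theorem stmt_5
    (n N L : ℕ) (hn : 0 < n) (hN : 0 < N) (hL : 0 < L) (hLN : L ≤ N)
    (f : ℕ → EuclideanSpace ℝ (Fin n) → EuclideanSpace ℝ (Fin n))
    (hf : ∀ i < N, ContDiff ℝ 1 (f i))
    (q : ℕ → ℕ) (hq0 : q 0 = 0) (hqL : q L = N)
    (hqmono : ∀ ℓ < L, q ℓ < q (ℓ + 1))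
    (F : ℕ → EuclideanSpace ℝ (Fin n) → EuclideanSpace ℝ (Fin n))
    (hF0 : ∀ x, F 0 x = 0)
    (hF : ∀ ℓ, 1 ≤ ℓ → ℓ ≤ L → ∀ x,
      F ℓ x = (q ℓ : ℝ)⁻¹ • ∑ i ∈ Finset.range (q ℓ), f i x)
    (t : ℕ → ℝ) (ht0 : t 0 = 1) (htL : t L = 0)
    (htmono : ∀ ℓ < L, t (ℓ + 1) < t ℓ)
    (θ : ℕ → ℝ → ℝ)
    (hθ : ∀ ℓ s, θ ℓ s = Real.sin (π / 2 * ((s - t (ℓ - 1)) / (t ℓ - t (ℓ - 1)))) ^ 2)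
    (d : EuclideanSpace ℝ (Fin n) → ℝ → EuclideanSpace ℝ (Fin n))
    (hd : ∀ ℓ, 1 ≤ ℓ → ℓ ≤ L → ∀ s ∈ Icc (t ℓ) (t (ℓ - 1)), ∀ x,
      d x s = (1 - θ ℓ s) • F (ℓ - 1) x + θ ℓ s • F ℓ x)
    (x0 : EuclideanSpace ℝ (Fin n))
    (h : EuclideanSpace ℝ (Fin n) → ℝ → EuclideanSpace ℝ (Fin n))
    (hh : ∀ x s, h x s = (1 - s) • d x s + s • (x - x0))
    (X : Set (EuclideanSpace ℝ (Fin n))) (hXc : IsCompact X) (hXconv : Convex ℝ X)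
    (hXint : (interior X).Nonempty) (hx0 : x0 ∈ interior X)
    (ha1 : ∀ i < N, ∀ x ∉ interior X, 0 < ⟪x - x0, f i x⟫)
    :
    ∀ s ∈ Icc (0 : ℝ) 1, ∃ x ∈ interior X, x - h x s = x ∧ h x s = 0 := by
  have hqN : ∀ ℓ ≤ L, q ℓ ≤ N := by
    have hstep : ∀ k ℓ, ℓ + k ≤ L → q ℓ ≤ q (ℓ + k) := by
      intro k ℓ
      induction k with
      | zero => simp
      | succ k ih => exact fun hk => (ih (by omega)).trans (hqmono (ℓ + k) (by omega)).le
    intro ℓ hℓ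
    have := hstep (L - ℓ) ℓ (by omega)
    rwa [Nat.add_sub_cancel' hℓ, hqL] at this
  have hqpos : ∀ ℓ, 1 ≤ ℓ → ℓ ≤ L → 0 < q ℓ := by
    intro ℓ h1 hℓ
    have := hqmono (ℓ - 1) (by omega)
    rw [Nat.sub_add_cancel h1] at this
    omega
  have hFsmooth : ∀ ℓ ≤ L, ContDiff ℝ 1 (F ℓ) := by
    intro ℓ hℓ
    rcases Nat.eq_zero_or_pos ℓ with rfl | h1
    · rw [funext hF0]
      exact contDiff_const
    · rw [funext (hF ℓ h1 hℓ)]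
      exact ContDiff.const_smul _ (ContDiff.sum fun i hi =>
        hf i ((Finset.mem_range.1 hi).trans_le (hqN ℓ hℓ)))
  have hFpos : ∀ ℓ, 1 ≤ ℓ → ℓ ≤ L → ∀ x ∉ interior X, 0 < ⟪x - x0, F ℓ x⟫ := by
    intro ℓ h1 hℓ x hx
    have hqℓ := hqpos ℓ h1 hℓ
    rw [hF ℓ h1 hℓ, real_inner_smul_right, inner_sum]
    refine mul_pos (by positivity) (Finset.sum_pos (fun i hi =>
      ha1 i ((Finset.mem_range.1 hi).trans_le (hqN ℓ hℓ)) x hx) ⟨0, Finset.mem_range.2 hqℓ⟩)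
  have hFnonneg : ∀ ℓ ≤ L, ∀ x ∉ interior X, 0 ≤ ⟪x - x0, F ℓ x⟫ := by
    intro ℓ hℓ x hx
    rcases Nat.eq_zero_or_pos ℓ with rfl | h1
    · simp [hF0]
    · exact (hFpos ℓ h1 hℓ x hx).le
  intro s hs
  obtain ⟨ℓ, h1, hℓ, hsℓ, hθ1⟩ : ∃ ℓ, 1 ≤ ℓ ∧ ℓ ≤ L ∧ s ∈ Icc (t ℓ) (t (ℓ - 1)) ∧
      (s = 0 → θ ℓ s = 1) := by
    rcases hs.1.eq_or_lt with rfl | hs0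
    · have ht := htmono (L - 1) (by omega)
      rw [Nat.sub_add_cancel hL, htL] at ht
      refine ⟨L, hL, le_rfl, ⟨htL.le, ht.le⟩, fun _ => ?_⟩
      rw [hθ, htL, div_self (by linarith), mul_one, Real.sin_pi_div_two, one_pow]
    · have hex : ∃ ℓ, 1 ≤ ℓ ∧ t ℓ ≤ s := ⟨L, hL, htL.trans_le hs.1⟩
      classical
      obtain ⟨h1, h2⟩ := Nat.find_spec hex
      refine ⟨Nat.find hex, h1, Nat.find_min' hex ⟨hL, htL.trans_le hs.1⟩, ⟨h2, ?_⟩,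
        fun h0 => absurd h0 hs0.ne'⟩
      rcases h1.eq_or_lt with h | h
      · rw [← h, Nat.sub_self, ht0]
        exact hs.2
      · have := Nat.find_min hex (m := Nat.find hex - 1) (by omega)
        push Not at this
        exact (this (by omega)).le
  have hh' : ∀ x, h x s =
      (1 - s) • ((1 - θ ℓ s) • F (ℓ - 1) x + θ ℓ s • F ℓ x) + s • (x - x0) := fun x => by
    rw [hh, hd ℓ h1 hℓ s hsℓ]
  have hθ0 : 0 ≤ θ ℓ s := by rw [hθ]; positivity
  have hθle : θ ℓ s ≤ 1 := by rw [hθ]; exact Real.sin_sq_le_one _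
  have hsmooth : ContDiff ℝ 1 fun x => h x s := by
    rw [funext hh']
    have ha := hFsmooth (ℓ - 1) (by omega)
    have hb := hFsmooth ℓ hℓ
    fun_prop
  have hpos : ∀ x ∉ interior X, 0 < ⟪x - x0, h x s⟫ := by
    intro x hx
    have hb := hFpos ℓ h1 hℓ x hx
    have ha := hFnonneg (ℓ - 1) (by omega) x hx
    simp only [hh', inner_add_right, real_inner_smul_right, real_inner_self_eq_norm_sq]
    rcases hs.1.eq_or_lt with h0 | h0
    · rw [hθ1 h0.symm, ← h0]
      simpa using hb
    · have hxx : 0 < ‖x - x0‖ := norm_pos_iff.2 (sub_ne_zero.2 fun he => hx (he ▸ hx0))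
      have : 0 ≤ 1 - s := sub_nonneg.2 hs.2
      have : 0 ≤ 1 - θ ℓ s := sub_nonneg.2 hθle
      positivity
  obtain ⟨R, hR, hXR⟩ := hXc.isBounded.subset_ball_lt 0 x0
  obtain ⟨x, hx⟩ := exists_eq_zero_of_inner_pos hsmooth hR x0 fun x hxR =>
    hpos x fun hxX => (mem_ball_iff_norm.1 (hXR (interior_subset hxX))).not_ge hxR
  refine ⟨x, ?_, by rw [hx, sub_zero], hx⟩
  by_contra hxX
  simpa [hx] using hpos x hxX
end

section
/- (Browder's fixed point theorem) Let S be a nonempty, compact and convex subset of ℝ^n and let f : S × [0,1] → S be continuous. Then the set G = {(s,t) ∈ S × [0,1] : s = f(s,t)} contains a connected subset G^c such that G^c ∩ (S × {1}) ≠ ∅ and G^c ∩ (S × {0}) ≠ ∅. -/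
open Set

theorem even_card_rainbow {V I : Type*} [Fintype V] [DecidableEq V] [Fintype I] [DecidableEq I]
    [Nonempty I] (c : V → I) (F : Finset (Finset V))
    (hcard : ∀ R ∈ F, R.card = Fintype.card I)
    (hF : ∀ d : Finset V, d.card + 1 = Fintype.card I → Even (F.filter (d ⊆ ·)).card) :
    Even (F.filter (fun R => R.image c = Finset.univ)).card := by
  obtain ⟨i₀⟩ := ‹Nonempty I›
  let doors : Finset (Finset V) := Finset.univ.filter fun d =>
    d.card + 1 = Fintype.card I ∧ d.image c = Finset.univ.erase i₀
  have hsum : Even (∑ R ∈ F, (doors.filter (· ⊆ R)).card) := by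
    have := Finset.sum_card_bipartiteAbove_eq_sum_card_bipartiteBelow (s := doors) (t := F)
      (fun d R => d ⊆ R)
    unfold Finset.bipartiteAbove Finset.bipartiteBelow at this
    rw [← this]
    refine Finset.even_sum _ fun d hd => hF d ?_
    simp only [doors, Finset.mem_filter] at hd
    exact hd.2.1
  have hpar : ∀ R ∈ F, Odd (doors.filter (· ⊆ R)).card ↔ R.image c = Finset.univ := by
    intro R hR
    have hn := hcard R hR
    have hdoors : doors.filter (· ⊆ R) =
        (R.filter fun v => (R.erase v).image c = Finset.univ.erase i₀).image R.erase := by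
      ext d
      simp only [doors, Finset.mem_filter, Finset.mem_univ, true_and, Finset.mem_image]
      constructor
      · rintro ⟨⟨h1, h2⟩, h3⟩
        have h4 : (R \ d).card = 1 := by rw [Finset.card_sdiff_of_subset h3]; omega
        obtain ⟨v, hv⟩ := Finset.card_eq_one.1 h4
        have hvR : v ∈ R \ d := by simp [hv]
        have hd : R.erase v = d := by
          rw [← Finset.sdiff_singleton_eq_erase, ← hv, Finset.sdiff_sdiff_eq_self h3]
        exact ⟨v, ⟨(Finset.mem_sdiff.1 hvR).1, by rw [hd, h2]⟩, hd⟩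
      · rintro ⟨v, ⟨h1, h2⟩, rfl⟩
        refine ⟨⟨?_, h2⟩, Finset.erase_subset _ _⟩
        rw [Finset.card_erase_add_one h1, hn]
    rw [hdoors, Finset.card_image_of_injOn
      ((Finset.erase_injOn R).mono fun v hv => (Finset.mem_filter.1 hv).1)]
    constructor
    · intro hodd
      by_contra hne
      refine Nat.not_even_iff_odd.2 hodd ?_
      rcases (R.filter fun v => (R.erase v).image c = Finset.univ.erase i₀).eq_empty_or_nonempty
        with h | ⟨v, hv⟩
      · rw [h]; simp
      · obtain ⟨hvR, hv⟩ := Finset.mem_filter.1 hv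
        have hRc : R.image c = insert (c v) (Finset.univ.erase i₀) := by
          rw [← hv, ← Finset.image_insert, Finset.insert_erase hvR]
        have hvi : c v ≠ i₀ := fun h => hne <| by
          rw [hRc, h, Finset.insert_erase (Finset.mem_univ _)]
        have hmem : c v ∈ (R.erase v).image c := by rw [hv]; simp [hvi]
        obtain ⟨w, hw, hwv⟩ := Finset.mem_image.1 hmem
        have hinj : Set.InjOn c (R.erase v : Finset V) := by
          apply Finset.injOn_of_card_image_eq
          rw [hv, Finset.card_erase_of_mem (Finset.mem_univ _), Finset.card_erase_of_mem hvR, hn,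
            Finset.card_univ]
        have hwR := Finset.mem_of_mem_erase hw
        have hwne := Finset.ne_of_mem_erase hw
        suffices h : (R.filter fun v => (R.erase v).image c = Finset.univ.erase i₀) = {v, w} by
          rw [h, Finset.card_pair hwne.symm]; exact even_two
        ext x
        simp only [Finset.mem_filter, Finset.mem_insert, Finset.mem_singleton]
        constructor
        · rintro ⟨hxR, hx⟩
          by_contra! hxx
          have hxm : c x ∈ (R.erase x).image c := by
            rw [hx]
            have : c x ∈ (R.erase v).image c :=
              Finset.mem_image_of_mem _ (Finset.mem_erase.2 ⟨hxx.1, hxR⟩)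
            rwa [hv] at this
          have hinj' : Set.InjOn c (R.erase x : Finset V) := by
            apply Finset.injOn_of_card_image_eq
            rw [hx, Finset.card_erase_of_mem (Finset.mem_univ _), Finset.card_erase_of_mem hxR,
              hn, Finset.card_univ]
          exact hwne (hinj' (by simp [hwR, hxx.2.symm]) (by simp [hvR, hxx.1.symm]) hwv)
        · rintro (rfl | rfl)
          · exact ⟨hvR, hv⟩
          · refine ⟨hwR, ?_⟩
            rw [← hv]
            ext i
            simp only [Finset.mem_image, Finset.mem_erase]
            constructor
            · rintro ⟨y, ⟨hy1, hy2⟩, rfl⟩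
              by_cases hyv : y = v
              · exact ⟨x, ⟨hwne, hwR⟩, by rw [hyv, hwv]⟩
              · exact ⟨y, ⟨hyv, hy2⟩, rfl⟩
            · rintro ⟨y, ⟨hy1, hy2⟩, rfl⟩
              by_cases hyv : y = x
              · exact ⟨v, ⟨hwne.symm, hvR⟩, by rw [hyv, hwv]⟩
              · exact ⟨y, ⟨hyv, hy2⟩, rfl⟩
    · intro hR'
      have hinj : Set.InjOn c (R : Finset V) := by
        apply Finset.injOn_of_card_image_eq
        rw [hR', hn, Finset.card_univ]
      have : i₀ ∈ R.image c := by simp [hR']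
      obtain ⟨v, hvR, hv⟩ := Finset.mem_image.1 this
      suffices h : (R.filter fun v => (R.erase v).image c = Finset.univ.erase i₀) = {v} by
        rw [h, Finset.card_singleton]; exact odd_one
      ext x
      simp only [Finset.mem_filter, Finset.mem_singleton]
      constructor
      · rintro ⟨hxR, hx⟩
        by_contra hne
        have : c v ∈ (R.erase x).image c :=
          Finset.mem_image_of_mem _ (Finset.mem_erase.2 ⟨Ne.symm hne, hvR⟩)
        rw [hx, hv] at this
        simp at this
      · rintro rfl
        refine ⟨hvR, ?_⟩
        ext i
        simp only [Finset.mem_image, Finset.mem_erase, Finset.mem_univ, and_true]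
        constructor
        · rintro ⟨y, ⟨hy1, hy2⟩, rfl⟩ h
          exact hy1 (hinj hy2 hvR (h.trans hv.symm))
        · intro hi
          have : i ∈ R.image c := by simp [hR']
          obtain ⟨y, hy, rfl⟩ := Finset.mem_image.1 this
          exact ⟨y, ⟨fun h => hi (by rw [h, hv]), hy⟩, rfl⟩
  rw [← Nat.not_odd_iff_even, Finset.odd_sum_iff_odd_card_odd, Nat.not_odd_iff_even] at hsum
  rwa [Finset.filter_congr hpar] at hsum

/-- `R` is dominant for the family `r` of rankings if no `y` beats, in every ranking, all of the
minimal elements of `R`. -/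
def IsDominant {V I α : Type*} [LE α] (r : I → V → α) (R : Finset V) : Prop :=
  ∀ y, ∃ i, ∀ x ∈ R, r i y ≤ r i x

theorem IsDominant.mono {V I α : Type*} [LE α] {r : I → V → α} {R d : Finset V}
    (hR : IsDominant r R) (h : d ⊆ R) : IsDominant r d := fun y =>
  (hR y).imp fun _ hi x hx => hi x (h hx)

theorem IsDominant.exists_minimizers {V I α : Type*} [DecidableEq V] [Fintype I]
    [DecidableEq I] [LinearOrder α] {r : I → V → α} (hr : ∀ i, Function.Injective (r i))
    {d : Finset V} (hd : IsDominant r d) (hne : d.Nonempty) (hcard : d.card + 1 = Fintype.card I) :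
    ∃ (m : I → V) (a b : I), a ≠ b ∧ (∀ i, m i ∈ d ∧ ∀ x ∈ d, r i (m i) ≤ r i x) ∧ m a = m b ∧
      (∀ i j, i ≠ j → m i = m j → i = a ∨ i = b) ∧
      ∀ y, (y ∉ d ∧ IsDominant r (insert y d)) ↔ ∃ i, (i = a ∨ i = b) ∧
        (∀ j, j ≠ i → r j (m j) < r j y) ∧
          ∀ z, (∀ j, j ≠ i → r j (m j) < r j z) → r i z ≤ r i y := by
  choose m hmd hm using fun i => Finset.exists_min_image d (r i) hne
  have hsurj : ∀ x ∈ d, ∃ i, m i = x := by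
    intro x hx
    obtain ⟨i, hi⟩ := hd x
    exact ⟨i, hr i (le_antisymm (hm i x hx) (hi _ (hmd i)))⟩
  obtain ⟨a, -, b, -, hab, hmab⟩ := Finset.exists_ne_map_eq_of_card_lt_of_maps_to
    (s := Finset.univ) (t := d) (f := m) (by rw [Finset.card_univ]; omega) (fun i _ => hmd i)
  have himg : ∀ k, (k = a ∨ k = b) → (Finset.univ.erase k).image m = d := by
    intro k hk
    apply Finset.Subset.antisymm
    · intro x hx
      obtain ⟨i, -, rfl⟩ := Finset.mem_image.1 hx
      exact hmd i
    · intro x hx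
      obtain ⟨i, rfl⟩ := hsurj x hx
      by_cases hik : i = k
      · subst hik
        rcases hk with rfl | rfl
        · exact Finset.mem_image.2 ⟨b, by simp [hab.symm], hmab.symm⟩
        · exact Finset.mem_image.2 ⟨a, by simp [hab], hmab⟩
      · exact Finset.mem_image.2 ⟨i, by simp [hik], rfl⟩
  have hinj : ∀ k, (k = a ∨ k = b) → Set.InjOn m (Finset.univ.erase k : Finset I) := by
    intro k hk
    apply Finset.injOn_of_card_image_eq
    rw [himg k hk, Finset.card_erase_of_mem (Finset.mem_univ _), Finset.card_univ]
    omega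
  refine ⟨m, a, b, hab, fun i => ⟨hmd i, hm i⟩, hmab, ?_, ?_⟩
  · intro i j hij hmij
    by_contra! h
    by_cases hja : j = a
    · exact hij (hinj b (Or.inr rfl) (by simp [h.2]) (by simp [hja, hab]) hmij)
    · exact hij (hinj a (Or.inl rfl) (by simp [h.1]) (by simp [hja]) hmij)
  · intro y
    constructor
    · rintro ⟨hyd, hdom⟩
      choose k hk using hdom
      have hkinj : Set.InjOn k (insert y d : Finset V) := by
        intro x hx x' hx' hxx
        exact hr (k x) (le_antisymm (hk x x' hx') (by rw [hxx]; exact hk x' x hx))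
      have hkimg : (insert y d).image k = Finset.univ := by
        apply Finset.eq_univ_of_card
        rw [Finset.card_image_of_injOn hkinj, Finset.card_insert_of_notMem hyd, hcard]
      have hkm : ∀ x ∈ d, m (k x) = x := fun x hx =>
        hr (k x) (le_antisymm (hm _ x hx) (hk x _ (Finset.mem_insert_of_mem (hmd _))))
      have hex : ∀ j, j ≠ k y → ∃ x ∈ d, k x = j := by
        intro j hj
        have : j ∈ (insert y d).image k := by simp [hkimg]
        obtain ⟨x, hx, rfl⟩ := Finset.mem_image.1 this
        rcases Finset.mem_insert.1 hx with rfl | hx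
        · exact absurd rfl hj
        · exact ⟨x, hx, rfl⟩
      refine ⟨k y, ?_, ?_, ?_⟩
      · by_contra! h
        obtain ⟨x, hx, hxa⟩ := hex a h.1.symm
        obtain ⟨x', hx', hxb⟩ := hex b h.2.symm
        have h1 := hkm x hx
        have h2 := hkm x' hx'
        rw [hxa] at h1
        rw [hxb] at h2
        exact hab (by rw [← hxa, ← hxb, ← h1, ← h2, hmab])
      · intro j hj
        obtain ⟨x, hx, rfl⟩ := hex j hj
        rw [hkm x hx]
        refine lt_of_le_of_ne (hk x y (Finset.mem_insert_self _ _)) fun h => ?_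
        exact hyd (hr _ h ▸ hx)
      · intro z hz
        have : k z = k y := by
          by_contra h
          exact absurd (hk z _ (Finset.mem_insert_of_mem (hmd _))) (not_le.2 (hz _ h))
        rw [← this]
        exact hk z y (Finset.mem_insert_self _ _)
    · rintro ⟨i, hi, hy, hmax⟩
      refine ⟨fun hyd => ?_, fun z => ?_⟩
      · rw [← himg i hi] at hyd
        obtain ⟨j, hj, rfl⟩ := Finset.mem_image.1 hyd
        exact lt_irrefl _ (hy j (Finset.ne_of_mem_erase hj))
      · by_cases hz : ∀ j, j ≠ i → r j (m j) < r j z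
        · refine ⟨i, fun x hx => ?_⟩
          rcases Finset.mem_insert.1 hx with rfl | hx
          · exact hmax z hz
          · obtain ⟨k, hk⟩ := hd z
            have : k = i := by
              by_contra h
              exact absurd (hk _ (hmd _)) (not_le.2 (hz _ h))
            exact this ▸ hk x hx
        · push Not at hz
          obtain ⟨j, hj, hz⟩ := hz
          refine ⟨j, fun x hx => ?_⟩
          rcases Finset.mem_insert.1 hx with rfl | hx
          · exact hz.trans (hy j hj).le
          · exact hz.trans (hm j x hx)

theorem exists_rainbow_dominant {V I α : Type*} [Fintype V] [DecidableEq V] [Fintype I]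
    [DecidableEq I] [Nontrivial I] [LinearOrder α] {r : I → V → α}
    (hr : ∀ i, Function.Injective (r i)) {b : I → V} (hb : Function.Injective b)
    (hb_min : ∀ i v, v ≠ b i → r i (b i) < r i v)
    (hb_top : ∀ i j v, j ≠ i → v ∉ range b → r i v < r i (b j))
    {t : V} (ht : t ∉ range b) {c : V → I} (hc : ∀ i, c (b i) = i) :
    ∃ R : Finset V, R.card = Fintype.card I ∧ IsDominant r R ∧ R.image c = Finset.univ := by
  classical
  have hmin : ∀ i v, r i (b i) ≤ r i v := fun i v => by
    by_cases h : v = b i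
    · rw [h]
    · exact (hb_min i v h).le
  set B : Finset V := Finset.univ.image b with hB
  have hmemB : ∀ v, v ∈ B ↔ v ∈ range b := fun v => by simp [hB]
  have hBcard : B.card = Fintype.card I := by
    rw [hB, Finset.card_image_of_injective _ hb, Finset.card_univ]
  have hBdom : ¬ IsDominant r B := fun h => by
    obtain ⟨i, hi⟩ := h t
    exact absurd (hi (b i) (by simp [hB])) (not_le.2 (hb_min i t fun h => ht ⟨i, h.symm⟩))
  set F : Finset (Finset V) :=
    Finset.univ.filter fun R => R.card = Fintype.card I ∧ IsDominant r R with hF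
  have hBF : B ∉ F := fun h => hBdom (Finset.mem_filter.1 h).2.2
  have heven : Even ((insert B F).filter (fun R => R.image c = Finset.univ)).card := by
    refine even_card_rainbow c (insert B F) ?_ ?_
    · intro R hR
      rcases Finset.mem_insert.1 hR with rfl | hR
      · exact hBcard
      · exact (Finset.mem_filter.1 hR).2.1
    · intro d hdc
      have hne : d.Nonempty := by
        have := Fintype.one_lt_card (α := I)
        exact Finset.card_pos.1 (by omega)
      have hface : d ⊆ B → ∃ i, d = B.erase (b i) := by
        intro hdB
        have h4 : (B \ d).card = 1 := by rw [Finset.card_sdiff_of_subset hdB]; omega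
        obtain ⟨v, hv⟩ := Finset.card_eq_one.1 h4
        have hvB : v ∈ B \ d := by simp [hv]
        obtain ⟨i, rfl⟩ := (hmemB v).1 (Finset.mem_sdiff.1 hvB).1
        exact ⟨i, by rw [← Finset.sdiff_singleton_eq_erase, ← hv, Finset.sdiff_sdiff_eq_self hdB]⟩
      by_cases hd : IsDominant r d
      swap
      · have hdB : ¬ d ⊆ B := by
          intro hdB
          obtain ⟨i, rfl⟩ := hface hdB
          apply hd
          intro y
          by_cases hy : y ∈ range b
          · obtain ⟨l, rfl⟩ := hy
            exact ⟨l, fun x _ => hmin l x⟩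
          · refine ⟨i, fun x hx => ?_⟩
            obtain ⟨hx1, hx2⟩ := Finset.mem_erase.1 hx
            obtain ⟨j, rfl⟩ := (hmemB x).1 hx2
            exact (hb_top i j y (fun h => hx1 (by rw [h])) hy).le
        have : (insert B F).filter (d ⊆ ·) = ∅ := by
          refine Finset.filter_eq_empty_iff.2 fun R hR hdR => ?_
          rcases Finset.mem_insert.1 hR with rfl | hR
          · exact hdB hdR
          · exact hd ((Finset.mem_filter.1 hR).2.2.mono hdR)
        rw [this]; simp
      obtain ⟨m, p, q, hpq, hm, hmpq, hdup, hroom⟩ := hd.exists_minimizers hr hne hdc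
      have hrooms : ∀ R, (R ∈ F ∧ d ⊆ R) ↔ ∃ y, R = insert y d ∧ ∃ i, (i = p ∨ i = q) ∧
          (∀ j, j ≠ i → r j (m j) < r j y) ∧
            ∀ z, (∀ j, j ≠ i → r j (m j) < r j z) → r i z ≤ r i y := by
        intro R
        constructor
        · rintro ⟨hR, hdR⟩
          obtain ⟨hRc, hRd⟩ := (Finset.mem_filter.1 hR).2
          have h4 : (R \ d).card = 1 := by rw [Finset.card_sdiff_of_subset hdR]; omega
          obtain ⟨y, hy⟩ := Finset.card_eq_one.1 h4
          have hyR : y ∈ R \ d := by simp [hy]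
          have hRy : R = insert y d := by
            rw [Finset.insert_eq, ← hy, Finset.sdiff_union_of_subset hdR]
          exact ⟨y, hRy, (hroom y).1 ⟨(Finset.mem_sdiff.1 hyR).2, hRy ▸ hRd⟩⟩
        · rintro ⟨y, rfl, h⟩
          obtain ⟨hy, hdom⟩ := (hroom y).2 h
          refine ⟨Finset.mem_filter.2 ⟨Finset.mem_univ _, ?_, hdom⟩, Finset.subset_insert _ _⟩
          rw [Finset.card_insert_of_notMem hy, hdc]
      have hmax : ∀ i, (∃ y, ∀ j, j ≠ i → r j (m j) < r j y) →
          ∃ y, (∀ j, j ≠ i → r j (m j) < r j y) ∧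
            ∀ z, (∀ j, j ≠ i → r j (m j) < r j z) → r i z ≤ r i y := by
        rintro i ⟨y, hy⟩
        obtain ⟨w, hw, hw'⟩ := Finset.exists_max_image
          (Finset.univ.filter fun y => ∀ j, j ≠ i → r j (m j) < r j y) (r i) ⟨y, by simpa using hy⟩
        simp only [Finset.mem_filter, Finset.mem_univ, true_and] at hw hw'
        exact ⟨w, hw, hw'⟩
      have hnotmem : ∀ i, (i = p ∨ i = q) → ∀ y, (∀ j, j ≠ i → r j (m j) < r j y) →
          (∀ z, (∀ j, j ≠ i → r j (m j) < r j z) → r i z ≤ r i y) → y ∉ d :=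
        fun i hi y h1 h2 => ((hroom y).2 ⟨i, hi, h1, h2⟩).1
      by_cases hdB : d ⊆ B
      · obtain ⟨i₀, rfl⟩ := hface hdB
        have hmj : ∀ j, j ≠ i₀ → m j = b j := fun j hj => by
          by_contra h
          refine absurd ((hm j).2 (b j) ?_) (not_le.2 (hb_min j _ h))
          simp [hB, hb.ne hj]
        obtain ⟨k, hki, hk, hpqk⟩ : ∃ k, k ≠ i₀ ∧ m i₀ = b k ∧
            ∀ i, (i = p ∨ i = q) ↔ (i = i₀ ∨ i = k) := by
          by_cases hp : p = i₀
          · subst hp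
            exact ⟨q, hpq.symm, by rw [hmpq, hmj q hpq.symm], fun i => Iff.rfl⟩
          · by_cases hq : q = i₀
            · subst hq
              exact ⟨p, hpq, by rw [← hmpq, hmj p hpq], fun i => or_comm⟩
            · rw [hmj p hp, hmj q hq] at hmpq
              exact absurd (hb hmpq) hpq
        obtain ⟨y, hy1, hy2⟩ := hmax i₀ ⟨t, fun j hj => by
          rw [hmj j hj]; exact hb_min j t fun h => ht ⟨j, h.symm⟩⟩
        have hempty : ∀ y, ¬ ∀ j, j ≠ k → r j (m j) < r j y := by
          intro y hy
          have h1 := hy i₀ hki.symm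
          rw [hk] at h1
          by_cases hyb : y ∈ range b
          · obtain ⟨l, rfl⟩ := hyb
            by_cases hlk : l = k
            · rw [hlk] at h1; exact lt_irrefl _ h1
            · by_cases hli : l = i₀
              · rw [hli] at h1; exact absurd h1 (not_lt.2 (hmin _ _))
              · have := hy l hlk
                rw [hmj l hli] at this
                exact lt_irrefl _ this
          · exact lt_asymm h1 (hb_top i₀ k y hki hyb)
        suffices h : (insert B F).filter (B.erase (b i₀) ⊆ ·) =
            {B, insert y (B.erase (b i₀))} by
          rw [h, Finset.card_pair]
          · exact even_two
          · intro h
            apply hBdom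
            rw [h]
            exact ((hroom y).2 ⟨i₀, (hpqk i₀).2 (Or.inl rfl), hy1, hy2⟩).2
        ext R
        rw [Finset.mem_filter, Finset.mem_insert, Finset.mem_insert, Finset.mem_singleton, or_and_right,
          hrooms R]
        apply or_congr
        · exact ⟨fun h => h.1, fun h => ⟨h, h ▸ Finset.erase_subset _ _⟩⟩
        · constructor
          · rintro ⟨w, rfl, i, hi, hw1, hw2⟩
            rcases (hpqk i).1 hi with rfl | rfl
            · rw [hr i (le_antisymm (hw2 y hy1) (hy2 w hw1))]
            · exact absurd hw1 (hempty w)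
          · rintro rfl
            exact ⟨y, rfl, i₀, (hpqk i₀).2 (Or.inl rfl), hy1, hy2⟩
      · obtain ⟨s, hsd, hsB⟩ := Finset.not_subset.1 hdB
        rw [hmemB] at hsB
        have hnon : ∀ i, ∃ y, ∀ j, j ≠ i → r j (m j) < r j y := fun i =>
          ⟨b i, fun j hj => ((hm j).2 s hsd).trans_lt (hb_top j i s hj.symm hsB)⟩
        obtain ⟨y, hy1, hy2⟩ := hmax p (hnon p)
        obtain ⟨w, hw1, hw2⟩ := hmax q (hnon q)
        have hyd := hnotmem p (Or.inl rfl) y hy1 hy2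
        have hyw : y ≠ w := by
          rintro rfl
          obtain ⟨i, hi⟩ := hd y
          by_cases hip : i = p
          · exact absurd (hi _ (hm i).1) (not_le.2 (hw1 i (hip ▸ hpq)))
          · exact absurd (hi _ (hm i).1) (not_le.2 (hy1 i hip))
        suffices h : (insert B F).filter (d ⊆ ·) = {insert y d, insert w d} by
          rw [h, Finset.card_pair]
          · exact even_two
          · intro h
            have : y ∈ insert w d := h ▸ Finset.mem_insert_self y d
            exact (Finset.mem_insert.1 this).elim hyw hyd
        ext R
        rw [Finset.mem_filter, Finset.mem_insert, or_and_right, hrooms R, Finset.mem_insert,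
          Finset.mem_singleton]
        constructor
        · rintro (⟨rfl, h⟩ | ⟨v, rfl, i, hi, hv1, hv2⟩)
          · exact absurd h hdB
          · rcases hi with rfl | rfl
            · rw [hr i (le_antisymm (hv2 y hy1) (hy2 v hv1))]; exact Or.inl rfl
            · rw [hr i (le_antisymm (hv2 w hw1) (hw2 v hv1))]; exact Or.inr rfl
        · rintro (rfl | rfl)
          · exact Or.inr ⟨y, rfl, p, Or.inl rfl, hy1, hy2⟩
          · exact Or.inr ⟨w, rfl, q, Or.inr rfl, hw1, hw2⟩
  have hBc : B.image c = Finset.univ := by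
    ext i
    simp only [hB, Finset.mem_image, Finset.mem_univ, true_and, iff_true]
    exact ⟨b i, ⟨i, rfl⟩, hc i⟩
  rw [Finset.filter_insert, if_pos hBc, Finset.card_insert_of_notMem
    (fun h => hBF (Finset.mem_filter.1 h).1)] at heven
  have hpos : (F.filter fun R => R.image c = Finset.univ).Nonempty := by
    rw [Finset.nonempty_iff_ne_empty]
    intro h
    rw [h] at heven
    simp at heven
  obtain ⟨R, hR⟩ := hpos
  obtain ⟨hRF, hRc⟩ := Finset.mem_filter.1 hR
  exact ⟨R, (Finset.mem_filter.1 hRF).2.1, (Finset.mem_filter.1 hRF).2.2, hRc⟩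

theorem exists_rainbow_grid_cell {I : Type*} [Fintype I] [Nontrivial I] (N : ℕ)
    (c : (I → ℕ) → I) :
    ∃ v : I → ℕ, ∑ i, v i = N ∧ ∀ i, v i ≤ Fintype.card I ∨ ∃ w : I → ℕ, ∑ i, w i = N ∧ c w = i ∧
      ∀ j, v j ≤ w j + Fintype.card I ∧ w j ≤ v j + Fintype.card I := by
  classical
  let T := ↥(Finset.piAntidiag (Finset.univ : Finset I) N)
  have hT : ∀ v : T, ∑ i, v.1 i = N := fun v => (Finset.mem_piAntidiag.1 v.2).1
  let mk : ∀ v : I → ℕ, ∑ i, v i = N → T := fun v hv =>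
    ⟨v, Finset.mem_piAntidiag.2 ⟨hv, fun i _ => Finset.mem_univ i⟩⟩
  let h : I → T ⊕ I → ℕ := fun i =>
    Sum.elim (fun v => v.1 i + 1) (fun j => if j = i then 0 else N + 2)
  let e := Fintype.equivFin (T ⊕ I)
  let r : I → T ⊕ I → ℕ ×ₗ Fin (Fintype.card (T ⊕ I)) := fun i v => toLex (h i v, e v)
  have hlt : ∀ i v w, h i v < h i w → r i v < r i w := fun i v w hvw =>
    Prod.Lex.toLex_lt_toLex.2 (Or.inl hvw)
  have hle : ∀ i v w, r i v ≤ r i w → h i v ≤ h i w := fun i v w hvw =>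
    not_lt.1 fun h' => absurd hvw (not_le.2 (hlt i w v h'))
  have hr : ∀ i, Function.Injective (r i) := fun i v w hvw =>
    e.injective (congrArg Prod.snd (toLex.injective hvw))
  have hcoord : ∀ (v : T) i, v.1 i ≤ N := fun v i =>
    le_of_le_of_eq
      (Finset.single_le_sum (f := v.1) (fun _ _ => Nat.zero_le _) (Finset.mem_univ i)) (hT v)
  obtain ⟨i₁⟩ : Nonempty I := inferInstance
  let t : T := mk (fun i => if i = i₁ then N else 0) (by simp)
  obtain ⟨R, -, hRdom, hRc⟩ := exists_rainbow_dominant hr (b := Sum.inr) Sum.inr_injective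
    (fun i v hv => hlt _ _ _ <| by
      rcases v with v | j
      · simp [h]
      · have : j ≠ i := fun h => hv (by rw [h])
        simp [h, this])
    (fun i j v hji hv => hlt _ _ _ <| by
      rcases v with v | k
      · have := hcoord v i
        simp only [h, Sum.elim_inl, Sum.elim_inr, if_neg hji]
        omega
      · exact absurd ⟨k, rfl⟩ hv)
    (t := Sum.inl t) (by simp) (c := Sum.elim (fun v : T => c v.1) id) (fun i => rfl)
  have hdom : ∀ y : T, ∃ i, Sum.inr i ∉ R ∧ ∀ x : T, Sum.inl x ∈ R → y.1 i ≤ x.1 i := by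
    intro y
    obtain ⟨i, hi⟩ := hRdom (Sum.inl y)
    refine ⟨i, fun hiR => ?_, fun x hx => ?_⟩
    · have := hle _ _ _ (hi _ hiR)
      simp [h] at this
    · have := hle _ _ _ (hi _ hx)
      simpa [h] using this
  have hrain : ∀ i, Sum.inr i ∉ R → ∃ x : T, Sum.inl x ∈ R ∧ c x.1 = i := by
    intro i hi
    have : i ∈ R.image (Sum.elim (fun v : T => c v.1) id) := by simp [hRc]
    obtain ⟨x, hx, hxi⟩ := Finset.mem_image.1 this
    rcases x with x | j
    · exact ⟨x, hx, hxi⟩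
    · exact absurd ((show j = i from hxi) ▸ hx) hi
  obtain ⟨k, hk, -⟩ := hdom t
  obtain ⟨v, hvR, -⟩ := hrain k hk
  choose u hu hmin using fun i => Finset.exists_min_image
    (Finset.univ.filter fun x : T => Sum.inl x ∈ R) (fun x => x.1 i) ⟨v, by simpa using hvR⟩
  simp only [Finset.mem_filter, Finset.mem_univ, true_and] at hu hmin
  let m : I → ℕ := fun i => if Sum.inr i ∉ R then (u i).1 i else 0
  have hm : ∀ x : T, Sum.inl x ∈ R → ∀ i, m i ≤ x.1 i := by
    intro x hx i
    simp only [m]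
    split_ifs
    · exact Nat.zero_le _
    · exact hmin i x hx
  have hsum : N ≤ ∑ i, m i + Fintype.card I := by
    by_contra! hlt
    have hsum1 : ∑ i, (m i + 1) ≤ N := by
      rw [Finset.sum_add_distrib]
      simpa using hlt.le
    obtain ⟨i, hi, hyi⟩ := hdom (mk (fun i => m i + 1 + if i = i₁ then N - ∑ i, (m i + 1) else 0) (by
      rw [Finset.sum_add_distrib, Finset.sum_ite_eq' Finset.univ i₁]
      simp only [Finset.mem_univ, if_true]
      omega))
    have := hyi (u i) (hu i)
    simp only [mk, m, if_pos hi] at this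
    omega
  have hupper : ∀ x : T, Sum.inl x ∈ R → ∀ i, x.1 i ≤ m i + Fintype.card I := by
    intro x hx i
    have h1 := Finset.add_sum_erase Finset.univ x.1 (Finset.mem_univ i)
    have h2 := Finset.add_sum_erase Finset.univ m (Finset.mem_univ i)
    have h3 : ∑ j ∈ Finset.univ.erase i, m j ≤ ∑ j ∈ Finset.univ.erase i, x.1 j :=
      Finset.sum_le_sum fun j _ => hm x hx j
    have h4 := hT x
    omega
  refine ⟨v.1, hT v, fun i => ?_⟩
  by_cases hi : Sum.inr i ∈ R
  · left
    have := hupper v hvR i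
    simpa [m, hi] using this
  · obtain ⟨w, hwR, hwi⟩ := hrain i hi
    refine Or.inr ⟨w.1, hT w, hwi, fun j => ?_⟩
    have h1 := hm v hvR j
    have h2 := hm w hwR j
    have h3 := hupper v hvR j
    have h4 := hupper w hwR j
    omega

/-- **Brouwer's fixed point theorem** for the standard simplex. -/
theorem exists_fixedPoint_of_mapsTo_stdSimplex {I : Type*} [Fintype I] [Nonempty I]
    {g : (I → ℝ) → I → ℝ} (hg : ContinuousOn g (stdSimplex ℝ I))
    (hmaps : MapsTo g (stdSimplex ℝ I) (stdSimplex ℝ I)) :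
    ∃ x ∈ stdSimplex ℝ I, g x = x := by
  classical
  have hle_eq : ∀ x ∈ stdSimplex ℝ I, (∀ i, x i ≤ g x i) → g x = x := by
    intro x hx hle
    have hsum : ∑ i, x i = ∑ i, g x i := by rw [hx.2, (hmaps hx).2]
    funext i
    exact ((Finset.sum_eq_sum_iff_of_le fun i _ => hle i).1 hsum i (Finset.mem_univ i)).symm
  have hne : (stdSimplex ℝ I).Nonempty := by
    obtain ⟨i⟩ := ‹Nonempty I›
    exact ⟨_, single_mem_stdSimplex ℝ i⟩
  rcases subsingleton_or_nontrivial I with hI | hI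
  · obtain ⟨x, hx⟩ := hne
    refine ⟨x, hx, hle_eq x hx fun i => ?_⟩
    have h1 := hx.2
    have h2 := (hmaps hx).2
    rw [Fintype.sum_subsingleton _ i] at h1 h2
    rw [h1, h2]
  have happrox : ∀ ε > 0, ∃ x ∈ stdSimplex ℝ I, ∀ i, x i - g x i ≤ ε := by
    intro ε hε
    obtain ⟨δ, hδ, hgδ⟩ := Metric.uniformContinuousOn_iff.1
      ((isCompact_stdSimplex ℝ I).uniformContinuousOn_of_continuous hg) (ε / 2) (half_pos hε)
    set n : ℝ := (Fintype.card I : ℝ) with hn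
    have hδε : 0 < min δ (ε / 2) := lt_min hδ (half_pos hε)
    obtain ⟨N, hN⟩ := exists_nat_gt (n / min δ (ε / 2))
    have hN0 : (0 : ℝ) < N := lt_of_le_of_lt (by positivity) hN
    have hnN : n / N < min δ (ε / 2) := by
      rw [div_lt_iff₀ hδε] at hN
      rw [div_lt_iff₀ hN0]
      linarith
    have hmem : ∀ w : I → ℕ, ∑ i, w i = N → (fun i => (w i : ℝ) / N) ∈ stdSimplex ℝ I := by
      intro w hw
      refine ⟨fun i => by positivity, ?_⟩
      rw [← Finset.sum_div, ← Nat.cast_sum, hw, div_self hN0.ne']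
    have hcolor : ∀ w : I → ℕ, ∃ i, ∑ i, w i = N →
        (w i : ℝ) / N ≤ g (fun i => (w i : ℝ) / N) i := by
      intro w
      by_cases hw : ∑ i, w i = N
      · by_contra! h
        have hlt := Finset.sum_lt_sum_of_nonempty Finset.univ_nonempty fun i _ => (h i).2
        rw [(hmaps (hmem w hw)).2, (hmem w hw).2] at hlt
        exact lt_irrefl _ hlt
      · exact ⟨Classical.arbitrary I, fun h => absurd h hw⟩
    choose c hc using hcolor
    obtain ⟨v, hv, hvc⟩ := exists_rainbow_grid_cell N c
    refine ⟨_, hmem v hv, fun i => ?_⟩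
    rcases hvc i with hi | ⟨w, hw, rfl, hvw⟩
    · have h1 : (v i : ℝ) / N ≤ n / N := by
        have : (v i : ℝ) ≤ n := by rw [hn]; exact_mod_cast hi
        gcongr
      have h2 := (hmaps (hmem v hv)).1 i
      have h3 := hnN.trans_le (min_le_right _ _)
      linarith
    · have hclose : ∀ j, |(v j : ℝ) / N - w j / N| ≤ n / N := by
        intro j
        rw [← sub_div, abs_div, abs_of_pos hN0]
        obtain ⟨h1, h2⟩ := hvw j
        have h1' : (v j : ℝ) ≤ w j + n := by rw [hn]; exact_mod_cast h1
        have h2' : (w j : ℝ) ≤ v j + n := by rw [hn]; exact_mod_cast h2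
        gcongr
        rw [abs_le]
        constructor <;> linarith
      have hdist := hgδ _ (hmem v hv) _ (hmem w hw) (by
        refine lt_of_le_of_lt ((dist_pi_le_iff (by positivity)).2 fun j => ?_)
          (hnN.trans_le (min_le_left _ _))
        rw [Real.dist_eq]
        exact hclose j)
      have h1 := (dist_le_pi_dist _ _ (c w)).trans_lt hdist
      rw [Real.dist_eq, abs_lt] at h1
      have h2 := (abs_le.1 (hclose (c w))).2
      have h3 := hc w hw
      have h4 := hnN.trans_le (min_le_right _ _)
      linarith [h1.1]
  have hφ : ContinuousOn (fun x => ∑ i, max 0 (x i - g x i)) (stdSimplex ℝ I) := by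
    refine continuousOn_finsetSum _ fun i _ => ContinuousOn.sup continuousOn_const ?_
    exact (continuous_apply i).continuousOn.sub ((continuous_apply i).comp_continuousOn hg)
  obtain ⟨x, hx, hxmin⟩ := (isCompact_stdSimplex ℝ I).exists_isMinOn hne hφ
  refine ⟨x, hx, hle_eq x hx fun i => ?_⟩
  by_contra! hi
  set η := ∑ i, max 0 (x i - g x i) with hη
  have hηpos : 0 < η := by
    refine lt_of_lt_of_le ?_ (Finset.single_le_sum (f := fun i => max 0 (x i - g x i))
      (fun _ _ => le_max_left _ _) (Finset.mem_univ i))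
    exact lt_max_of_lt_right (sub_pos.2 hi)
  have hcard : (0 : ℝ) < Fintype.card I := by exact_mod_cast Fintype.card_pos
  obtain ⟨y, hy, hyε⟩ := happrox (η / 2 / Fintype.card I) (by positivity)
  have h1 : η ≤ ∑ i, max 0 (y i - g y i) := hxmin hy
  have h2 : ∑ i, max 0 (y i - g y i) ≤ ∑ _i : I, η / 2 / Fintype.card I :=
    Finset.sum_le_sum fun i _ => max_le (by positivity) (hyε i)
  rw [Finset.sum_const, Finset.card_univ, nsmul_eq_mul, mul_div_cancel₀ _ hcard.ne'] at h2
  linarith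

/-- **Schauder's fixed point theorem** for compact convex subsets of a normed space. -/
theorem exists_fixedPoint_of_mapsTo_compact_convex {E : Type*} [NormedAddCommGroup E]
    [NormedSpace ℝ E] {K : Set E} (hK : IsCompact K) (hconv : Convex ℝ K) (hne : K.Nonempty)
    {g : E → E} (hg : ContinuousOn g K) (hmaps : MapsTo g K K) : ∃ x ∈ K, g x = x := by
  have happrox : ∀ ε > 0, ∃ x ∈ K, dist (g x) x ≤ ε := by
    intro ε hε
    obtain ⟨t, htK, htfin, hcover⟩ := hK.finite_cover_balls hε
    have : Fintype t := htfin.fintype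
    let w : t → E → ℝ := fun i y => max 0 (ε - dist y i)
    have hw0 : ∀ i y, 0 ≤ w i y := fun i y => le_max_left _ _
    have hw : ∀ i, Continuous (w i) := fun i => by fun_prop
    have hW : ∀ y ∈ K, 0 < ∑ i, w i y := by
      intro y hy
      obtain ⟨p, hp, hyp⟩ := mem_iUnion₂.1 (hcover hy)
      refine lt_of_lt_of_le ?_ (Finset.single_le_sum (f := fun i => w i y)
        (fun i _ => hw0 i y) (Finset.mem_univ ⟨p, hp⟩))
      exact lt_max_of_lt_right (sub_pos.2 (Metric.mem_ball.1 hyp))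
    have : Nonempty t := by
      obtain ⟨y, hy⟩ := hne
      obtain ⟨p, hp, -⟩ := mem_iUnion₂.1 (hcover hy)
      exact ⟨⟨p, hp⟩⟩
    let Φ : E → t → ℝ := fun y i => w i y / ∑ j, w j y
    let Ψ : (t → ℝ) → E := fun l => ∑ i, l i • (i : E)
    have hΦc : ContinuousOn Φ K := continuousOn_pi.2 fun i =>
      (hw i).continuousOn.div (continuous_finsetSum _ fun j _ => hw j).continuousOn
        fun y hy => (hW y hy).ne'
    have hΦm : MapsTo Φ K (stdSimplex ℝ t) := fun y hy =>
      ⟨fun i => div_nonneg (hw0 i y) (hW y hy).le, by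
        simp only [Φ]
        rw [← Finset.sum_div, div_self (hW y hy).ne']⟩
    have hΨc : Continuous Ψ := by fun_prop
    have hΨm : MapsTo Ψ (stdSimplex ℝ t) K := fun l hl =>
      hconv.sum_mem (fun i _ => hl.1 i) hl.2 fun i _ => htK i.2
    have hclose : ∀ y ∈ K, dist y (Ψ (Φ y)) ≤ ε := by
      intro y hy
      have hs := (hΦm hy).2
      have heq : Ψ (Φ y) - y = ∑ i, Φ y i • ((i : E) - y) := by
        simp only [smul_sub, Finset.sum_sub_distrib, ← Finset.sum_smul, hs, one_smul, Ψ]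
      rw [dist_comm, dist_eq_norm, heq]
      calc ‖∑ i, Φ y i • ((i : E) - y)‖ ≤ ∑ i, ‖Φ y i • ((i : E) - y)‖ := norm_sum_le _ _
        _ ≤ ∑ i, Φ y i * ε := by
          refine Finset.sum_le_sum fun i _ => ?_
          have h0 := (hΦm hy).1 i
          rw [norm_smul, Real.norm_of_nonneg h0]
          by_cases hi : dist y i ≤ ε
          · rw [dist_comm, dist_eq_norm] at hi
            gcongr
          · have : Φ y i = 0 := by
              simp only [Φ, w]
              rw [max_eq_left (by linarith), zero_div]
            simp [this]
        _ = ε := by rw [← Finset.sum_mul, hs, one_mul]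
    obtain ⟨l, hl, hfix⟩ := exists_fixedPoint_of_mapsTo_stdSimplex (g := fun l => Φ (g (Ψ l)))
      (hΦc.comp (hg.comp hΨc.continuousOn hΨm) fun l hl => hmaps (hΨm hl))
      (fun l hl => hΦm (hmaps (hΨm hl)))
    refine ⟨Ψ l, hΨm hl, ?_⟩
    have := hclose _ (hmaps (hΨm hl))
    rwa [show Φ (g (Ψ l)) = l from hfix] at this
  obtain ⟨x, hx, hxmin⟩ := hK.exists_isMinOn hne
    (continuous_dist.comp_continuousOn (hg.prodMk continuousOn_id))
  refine ⟨x, hx, ?_⟩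
  by_contra hne'
  have hpos : 0 < dist (g x) x := dist_pos.2 hne'
  obtain ⟨y, hy, hyε⟩ := happrox (dist (g x) x / 2) (half_pos hpos)
  have : dist (g x) x ≤ dist (g y) y := hxmin hy
  linarith

/-- In a compact Hausdorff space, two closed sets not both met by any connected component are
separated by a clopen set. -/
theorem exists_isClopen_of_disjoint_connectedComponent {X : Type*} [TopologicalSpace X]
    [T2Space X] [CompactSpace X] {A B : Set X} (hA : IsClosed A) (hB : IsClosed B)
    (hAB : ∀ x ∈ A, Disjoint (connectedComponent x) B) :
    ∃ U : Set X, IsClopen U ∧ A ⊆ U ∧ Disjoint U B := by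
  have hpt : ∀ x ∈ A, ∃ U : Set X, IsClopen U ∧ x ∈ U ∧ Disjoint U B := by
    intro x hx
    have h := hAB x hx
    rw [connectedComponent_eq_iInter_isClopen, disjoint_comm, disjoint_iff_inter_eq_empty] at h
    obtain ⟨u, hu⟩ := hB.isCompact.elim_finite_subfamily_closed _ (fun s => s.2.1.isClosed) h
    refine ⟨⋂ s ∈ u, s.1, u.finite_toSet.isClopen_biInter fun s _ => s.2.1,
      mem_iInter₂.2 fun s _ => s.2.2, ?_⟩
    rwa [disjoint_comm, disjoint_iff_inter_eq_empty]
  choose! U hU hxU hUB using hpt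
  obtain ⟨s, hsA, hs⟩ := hA.isCompact.elim_nhds_subcover U fun x hx =>
    (hU x hx).isOpen.mem_nhds (hxU x hx)
  exact ⟨⋃ x ∈ s, U x, s.finite_toSet.isClopen_biUnion fun x hx => hU x (hsA x hx), hs,
    disjoint_iUnion₂_left.2 fun x hx => hUB x (hsA x hx)⟩

/-- Browder's fixed point theorem: Let S be a nonempty, compact and convex
subset of ℝⁿ and let f : S × [0,1] → S be continuous. Then the fixed-point set
G = {(s,t) ∈ S × [0,1] : s = f(s,t)} contains a connected subset G^c meeting both
S × {1} and S × {0}. -/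
theorem stmt_6 (n : ℕ) (S : Set (EuclideanSpace ℝ (Fin n)))
    (hS : S.Nonempty) (hScomp : IsCompact S) (hSconv : Convex ℝ S)
    (f : EuclideanSpace ℝ (Fin n) × ℝ → EuclideanSpace ℝ (Fin n))
    (hmap : ∀ p ∈ S ×ˢ Icc (0 : ℝ) 1, f p ∈ S)
    (hcont : ContinuousOn f (S ×ˢ Icc (0 : ℝ) 1)) :
    ∃ Gc ⊆ {p ∈ S ×ˢ Icc (0 : ℝ) 1 | p.1 = f p},
      IsConnected Gc ∧
      (Gc ∩ S ×ˢ ({1} : Set ℝ)).Nonempty ∧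
      (Gc ∩ S ×ˢ ({0} : Set ℝ)).Nonempty := by
  set K := S ×ˢ Icc (0 : ℝ) 1 with hKdef
  have hK : IsCompact K := hScomp.prod isCompact_Icc
  set G := {p ∈ K | p.1 = f p} with hG
  have hGclosed : IsClosed G := by
    have : G = K ∩ (fun p => p.1 - f p) ⁻¹' {0} := by
      ext p
      simp [hG, sub_eq_zero]
    rw [this]
    exact (continuousOn_fst.sub hcont).preimage_isClosed_of_isClosed hK.isClosed isClosed_singleton
  have hGcomp : IsCompact G := hK.of_isClosed_subset hGclosed fun p hp => hp.1
  have : CompactSpace G := isCompact_iff_compactSpace.1 hGcomp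
  have ht : Continuous fun p : G => p.1.2 := continuous_snd.comp continuous_subtype_val
  by_contra! hno
  obtain ⟨U, hU, hU0, hU1⟩ := exists_isClopen_of_disjoint_connectedComponent
    (A := {p : G | p.1.2 = 0}) (B := {p : G | p.1.2 = 1})
    (isClosed_eq ht continuous_const) (isClosed_eq ht continuous_const) (by
      intro p hp
      rw [Set.disjoint_left]
      intro q hq hq1
      have hsub : Subtype.val '' connectedComponent p ⊆ G := Subtype.coe_image_subset _ _
      have h0 := hno _ hsub (isConnected_connectedComponent.image _ continuous_subtype_val.continuousOn)
        ⟨q.1, mem_image_of_mem _ hq, q.2.1.1, hq1⟩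
      exact h0.subset ⟨mem_image_of_mem _ mem_connectedComponent, p.2.1.1, hp⟩)
  have hemb := hGclosed.isClosedEmbedding_subtypeVal
  obtain ⟨u, hu0, hu1, -⟩ := exists_continuous_zero_one_of_isClosed
    (hemb.isClosedMap _ hU.isClosed) (hemb.isClosedMap _ hU.compl.isClosed)
    (disjoint_image_of_injective Subtype.val_injective disjoint_compl_right)
  obtain ⟨p, hpK, hp⟩ := exists_fixedPoint_of_mapsTo_compact_convex hK
    (hSconv.prod (convex_Icc 0 1)) (hS.prod ⟨0, by simp⟩)
    (g := fun p => (f p, max 0 (min 1 (p.2 + (1 - 2 * u p)))))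
    (hcont.prodMk (by fun_prop))
    (fun p hp => ⟨hmap p hp, le_max_left _ _, max_le zero_le_one (min_le_left _ _)⟩)
  have hpG : p ∈ G := ⟨hpK, (congrArg Prod.fst hp).symm⟩
  have hpt : max 0 (min 1 (p.2 + (1 - 2 * u p))) = p.2 := congrArg Prod.snd hp
  obtain ⟨h0, h1⟩ := hpK.2
  by_cases hpU : (⟨p, hpG⟩ : G) ∈ U
  · rw [show u p = 0 from hu0 ⟨_, hpU, rfl⟩, min_eq_left (by linarith),
      max_eq_right zero_le_one] at hpt
    exact Set.disjoint_left.1 hU1 hpU hpt.symm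
  · rw [show u p = 1 from hu1 ⟨_, hpU, rfl⟩, min_eq_right (by linarith),
      max_eq_left (by linarith)] at hpt
    exact hpU (hU0 hpt.symm)
end

section
/- (Corollary 3) Under Assumption 1, the solution set H⁻¹ = {(x,t) ∈ X × [0,1] : h(x,t) = 0} contains a connected subset H_c⁻¹ such that H_c⁻¹ ∩ (X × {0}) ≠ ∅ and H_c⁻¹ ∩ (X × {1}) ≠ ∅. -/
open Real Set RealInnerProductSpace

open Metric in
theorem lipschitzWith_indicator_closedBall {E F : Type*} [NormedAddCommGroup E] [NormedSpace ℝ E]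
    [NormedAddCommGroup F] {g : E → F} {K : NNReal} {R : ℝ}
    (hg : LipschitzOnWith K g (closedBall 0 R)) (h0 : ∀ x, ‖x‖ = R → g x = 0) :
    LipschitzWith K (indicator (closedBall 0 R) g) := by
  have key : ∀ x y : E, x ∈ closedBall (0 : E) R → y ∉ closedBall (0 : E) R →
      dist (g x) 0 ≤ K * dist x y := by
    intro x y hx hy
    rw [mem_closedBall_zero_iff] at hx hy
    have hc : ContinuousOn (fun s : ℝ => ‖AffineMap.lineMap x y s‖) (Icc 0 1) :=
      (AffineMap.lineMap_continuous (R := ℝ)).norm.continuousOn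
    obtain ⟨s, hs, hsR⟩ := intermediate_value_Icc (zero_le_one' ℝ) hc
      (show R ∈ Icc _ _ by simpa using ⟨hx, (not_le.1 hy).le⟩)
    rw [← h0 _ hsR]
    refine (hg.dist_le_mul x (by simpa using hx) _ (by simpa using hsR.le)).trans ?_
    rw [dist_left_lineMap]
    gcongr
    rw [Real.norm_of_nonneg hs.1]
    exact mul_le_of_le_one_left dist_nonneg hs.2
  refine LipschitzWith.of_dist_le_mul fun x y => ?_
  by_cases hx : x ∈ closedBall (0 : E) R <;> by_cases hy : y ∈ closedBall (0 : E) R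
  · simpa [indicator_of_mem hx, indicator_of_mem hy] using hg.dist_le_mul x hx y hy
  · simpa [indicator_of_mem hx, indicator_of_notMem hy] using key x y hx hy
  · simpa [indicator_of_notMem hx, indicator_of_mem hy, dist_comm] using key y x hy hx
  · simp only [indicator_of_notMem hx, indicator_of_notMem hy, dist_self]
    positivity

open Polynomial in
theorem ContinuousLinearMap.det_one_add_smul_eq_sum {E : Type*} [NormedAddCommGroup E]
    [NormedSpace ℝ E] [FiniteDimensional ℝ E] {S : Finset ℝ} (hS : Module.finrank ℝ E < S.card)
    (A : E →L[ℝ] E) (s : ℝ) :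
    (1 + s • A).det = ∑ j ∈ S, (1 + j • A).det * (Lagrange.basis S id j).eval s := by
  set b := Module.finBasis ℝ E
  set M := LinearMap.toMatrix b b (A : E →ₗ[ℝ] E)
  set p : ℝ[X] := Matrix.det ((X : ℝ[X]) • M.map C + (1 : Matrix _ _ ℝ).map C)
  have hp : ∀ j, (1 + j • A).det = p.eval j := by
    intro j
    have : ((1 + j • A : E →L[ℝ] E) : E →ₗ[ℝ] E) = 1 + j • (A : E →ₗ[ℝ] E) := rfl
    rw [ContinuousLinearMap.det, this, ← LinearMap.det_toMatrix b, ← Polynomial.coe_evalRingHom,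
      RingHom.map_det]
    congr 1
    ext i k
    rcases eq_or_ne i k with rfl | hik
    · simp [M, LinearMap.toMatrix_one]; ring
    · simp [M, LinearMap.toMatrix_one, hik]; ring
  have hdeg : p.degree < S.card := by
    refine (degree_le_natDegree).trans_lt ?_
    have := natDegree_det_X_add_C_le M (1 : Matrix _ _ ℝ)
    rw [Fintype.card_fin] at this
    exact_mod_cast this.trans_lt hS
  have h1 := Lagrange.eq_interpolate (v := id) (injOn_id _) hdeg
  rw [hp, h1, Lagrange.interpolate_apply, eval_finsetSum]
  refine Finset.sum_congr rfl fun j _ => ?_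
  rw [hp, eval_mul, eval_C]
  simp

theorem Lagrange.sum_eval_basis {S : Finset ℝ} (hS : S.Nonempty) (s : ℝ) :
    ∑ j ∈ S, (Lagrange.basis S id j).eval s = 1 := by
  rw [← Polynomial.eval_finsetSum, Lagrange.sum_basis (injOn_id _) hS, Polynomial.eval_one]

open MeasureTheory Metric Filter Topology in
/-- For small `s` the map `id + s • g` is a bijection of the ball, so the integral of its Jacobian
is the volume of the ball. -/
theorem eventually_integral_det_one_add_smul_fderiv {E : Type*} [NormedAddCommGroup E]
    [NormedSpace ℝ E] [FiniteDimensional ℝ E] [MeasurableSpace E] [BorelSpace E]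
    (μ : Measure E) [μ.IsAddHaarMeasure]
    {g : E → E} {R : ℝ} (hg : ContDiff ℝ 1 g) (h0 : ∀ x, ‖x‖ = R → g x = 0) :
    ∀ᶠ s : ℝ in 𝓝 0, ∫ x in closedBall 0 R, (1 + s • fderiv ℝ g x).det ∂μ =
      μ.real (closedBall 0 R) := by
  have hcont : Continuous (fderiv ℝ g) := hg.continuous_fderiv one_ne_zero
  obtain ⟨K, hK⟩ : ∃ K : NNReal, ∀ x ∈ closedBall (0 : E) R, ‖fderiv ℝ g x‖₊ ≤ K := by
    obtain ⟨K, hK⟩ := ((isCompact_closedBall (0 : E) R).image hcont.nnnorm).bddAbove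
    exact ⟨K, fun x hx => hK (mem_image_of_mem _ hx)⟩
  have hdiff : Differentiable ℝ g := hg.differentiable one_ne_zero
  have hlip := lipschitzWith_indicator_closedBall
    ((convex_closedBall (0 : E) R).lipschitzOnWith_of_nnnorm_fderiv_le
      (fun x _ => hdiff x) hK) h0
  set G := indicator (closedBall (0 : E) R) g
  obtain ⟨ε, hε, hdet⟩ : ∃ ε > 0, ∀ A : E →L[ℝ] E, ‖A‖ < ε → 0 < (1 + A).det := by
    have hc : Continuous fun A : E →L[ℝ] E => (1 + A).det :=
      ContinuousLinearMap.continuous_det.comp (continuous_const.add continuous_id)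
    have h1 : 0 < (1 + (0 : E →L[ℝ] E)).det := by simp [ContinuousLinearMap.det]
    obtain ⟨ε, hε, h⟩ := Metric.eventually_nhds_iff.1 (hc.continuousAt.eventually (lt_mem_nhds h1))
    exact ⟨ε, hε, fun A hA => h (by simpa using hA)⟩
  have hs1 : ∀ᶠ s : ℝ in 𝓝 0, ‖s‖ * K < ε :=
    (show Continuous fun s : ℝ => ‖s‖ * K by fun_prop).continuousAt.eventually
      (gt_mem_nhds (by simpa using hε))
  have hs2 : ∀ᶠ s : ℝ in 𝓝 0,
      ‖s‖₊ * K < ‖((ContinuousLinearEquiv.refl ℝ E).symm : E →L[ℝ] E)‖₊⁻¹ ∨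
        Subsingleton E := by
    by_cases hE : Subsingleton E
    · simp [hE]
    rw [not_subsingleton_iff_nontrivial] at hE
    have : ‖((ContinuousLinearEquiv.refl ℝ E).symm : E →L[ℝ] E)‖₊ = 1 :=
      ContinuousLinearMap.nnnorm_id
    rw [this]
    have h1 : ∀ᶠ s : ℝ in 𝓝 0, ‖s‖₊ * K < 1 :=
      (show Continuous fun s : ℝ => ‖s‖₊ * K by fun_prop).continuousAt.eventually
        (gt_mem_nhds (by simp))
    filter_upwards [h1] with s hs
    simpa using Or.inl hs
  filter_upwards [hs1, hs2] with s hs1 hs2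
  have happ : ApproximatesLinearOn (fun x => x + s • G x)
      ((ContinuousLinearEquiv.refl ℝ E : E ≃L[ℝ] E) : E →L[ℝ] E) univ (‖s‖₊ * K) := by
    rw [ApproximatesLinearOn.approximatesLinearOn_iff_lipschitzOnWith, lipschitzOnWith_univ]
    have : ((fun x => x + s • G x) - ⇑((ContinuousLinearEquiv.refl ℝ E : E ≃L[ℝ] E) : E →L[ℝ] E))
        = fun x => s • G x := by
      ext x; simp
    rw [this]
    exact (lipschitzWith_smul s).comp hlip
  have hinj : Function.Injective fun x => x + s • G x :=
    injOn_univ.1 (happ.injOn hs2.symm)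
  have hsurj : Function.Surjective fun x => x + s • G x := happ.surjective hs2.symm
  have heq : ∀ x ∈ closedBall (0 : E) R, x + s • G x = x + s • g x := fun x hx => by
    simp only [G, indicator_of_mem hx]
  have himg : (fun x => x + s • g x) '' closedBall 0 R = closedBall 0 R := by
    rw [← image_congr heq]
    have hout : ∀ x ∉ closedBall (0 : E) R, x + s • G x = x := fun x hx => by
      simp [G, indicator_of_notMem hx]
    have hcompl : (fun x => x + s • G x) '' (closedBall 0 R)ᶜ = (closedBall 0 R)ᶜ :=
      (image_congr (g := id) hout).trans (image_id _)
    rw [image_compl_eq ⟨hinj, hsurj⟩] at hcompl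
    exact compl_injective hcompl
  have hinj' : InjOn (fun x => x + s • g x) (closedBall 0 R) :=
    hinj.injOn.congr heq
  have hder : ∀ x ∈ closedBall (0 : E) R, HasFDerivWithinAt (fun x => x + s • g x)
      (1 + s • fderiv ℝ g x) (closedBall 0 R) x := fun x _ =>
    ((hasFDerivAt_id x).add ((hdiff x).hasFDerivAt.const_smul s)).hasFDerivWithinAt
  have hcv := integral_image_eq_integral_abs_det_fderiv_smul μ measurableSet_closedBall hder hinj'
    (fun _ => (1 : ℝ))
  rw [himg] at hcv
  simp only [smul_eq_mul, mul_one] at hcv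
  rw [setIntegral_const, smul_eq_mul, mul_one] at hcv
  rw [hcv]
  refine setIntegral_congr_fun measurableSet_closedBall fun x hx => ?_
  refine (abs_of_pos (hdet _ ?_)).symm
  rw [norm_smul]
  exact (mul_le_mul_of_nonneg_left (by exact_mod_cast hK x hx) (norm_nonneg s)).trans_lt hs1

open MeasureTheory Metric Filter Topology in
/-- If `g` vanishes on a sphere, then the integral of the Jacobian of `id + g` over the ball is the
volume of the ball. -/
theorem integral_det_one_add_fderiv {E : Type*} [NormedAddCommGroup E]
    [NormedSpace ℝ E] [FiniteDimensional ℝ E] [MeasurableSpace E] [BorelSpace E]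
    (μ : Measure E) [μ.IsAddHaarMeasure]
    {g : E → E} {R : ℝ} (hg : ContDiff ℝ 1 g) (h0 : ∀ x, ‖x‖ = R → g x = 0) :
    ∫ x in closedBall 0 R, (1 + fderiv ℝ g x).det ∂μ = μ.real (closedBall 0 R) := by
  have hcont : Continuous (fderiv ℝ g) := hg.continuous_fderiv one_ne_zero
  have hev := eventually_integral_det_one_add_smul_fderiv μ hg h0
  have hinf : {s : ℝ | ∫ x in closedBall 0 R, (1 + s • fderiv ℝ g x).det ∂μ =
      μ.real (closedBall 0 R)}.Infinite := infinite_of_mem_nhds 0 hev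
  obtain ⟨S, hS, hcard⟩ := hinf.exists_subset_card_eq (Module.finrank ℝ E + 1)
  have hdet := fun x => ContinuousLinearMap.det_one_add_smul_eq_sum (S := S) (by omega)
    (fderiv ℝ g x) 1
  simp only [one_smul] at hdet
  simp_rw [hdet]
  rw [integral_finsetSum]
  · simp_rw [integral_mul_const]
    rw [Finset.sum_congr rfl fun j hj => by rw [hS hj], ← Finset.mul_sum,
      Lagrange.sum_eval_basis (Finset.card_pos.1 (by omega)), mul_one]
  · intro j _
    refine ContinuousOn.integrableOn_compact (isCompact_closedBall _ _) (Continuous.continuousOn ?_)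
    exact (ContinuousLinearMap.continuous_det.comp
      (continuous_const.add (hcont.const_smul j))).mul_const _

open MeasureTheory Metric in
/-- A `C¹` map into a sphere cannot fix that sphere pointwise. -/
theorem exists_ne_of_contDiff_norm_eq {E : Type*} [NormedAddCommGroup E]
    [InnerProductSpace ℝ E] [FiniteDimensional ℝ E] {r : E → E} {R : ℝ} (hR : 0 < R)
    (hr : ContDiff ℝ 1 r) (hnorm : ∀ x, ‖r x‖ = R) : ∃ x, ‖x‖ = R ∧ r x ≠ x := by
  by_contra! hfix
  borelize E
  have hdr : Differentiable ℝ r := hr.differentiable one_ne_zero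
  have h := integral_det_one_add_fderiv (Measure.addHaar : Measure E) (g := fun x => r x - x)
    (hr.sub contDiff_id) (fun x hx => by rw [hfix x hx, sub_self])
  have hdet : ∀ x, (1 + fderiv ℝ (fun x => r x - x) x).det = 0 := by
    intro x
    have hfd : fderiv ℝ (fun x => r x - x) x = fderiv ℝ r x - 1 :=
      ((hdr x).hasFDerivAt.sub (hasFDerivAt_id x)).fderiv
    rw [hfd, add_sub_cancel]
    have horth : ∀ v, ⟪r x, fderiv ℝ r x v⟫ = 0 := by
      intro v
      have h1 : HasFDerivAt (fun y => ‖r y‖ ^ 2) _ x := (hdr x).hasFDerivAt.norm_sq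
      have h2 : HasFDerivAt (fun y => ‖r y‖ ^ 2) (0 : E →L[ℝ] ℝ) x := by
        simp_rw [hnorm]
        exact hasFDerivAt_const _ _
      simpa using congrArg (fun T : E →L[ℝ] ℝ => T v) (h1.unique h2)
    by_contra hne
    have hu : IsUnit (LinearMap.det (fderiv ℝ r x : E →ₗ[ℝ] E)) := isUnit_iff_ne_zero.2 hne
    obtain ⟨v, hv⟩ := (LinearMap.equivOfIsUnitDet hu).surjective (r x)
    have hv' : fderiv ℝ r x v = r x := by
      rw [← hv, LinearMap.equivOfIsUnitDet_apply]; rfl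
    have h3 := horth v
    rw [hv', real_inner_self_eq_norm_sq, hnorm] at h3
    exact (pow_pos hR 2).ne' h3
  simp only [hdet, integral_zero] at h
  exact (ENNReal.toReal_pos (measure_closedBall_pos _ _ hR).ne'
    measure_closedBall_lt_top.ne).ne h

theorem exists_eq_zero_of_contDiff {E : Type*} [NormedAddCommGroup E]
    [InnerProductSpace ℝ E] [FiniteDimensional ℝ E] {v : E → E} {R : ℝ} (hR : 0 < R)
    (hv : ContDiff ℝ 1 v) (hfix : ∀ x, ‖x‖ = R → v x = x) : ∃ x, v x = 0 := by
  by_contra! hne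
  obtain ⟨x, hx, hrx⟩ := exists_ne_of_contDiff_norm_eq (r := fun x => (R / ‖v x‖) • v x) hR
    ((contDiff_const.div (hv.norm ℝ hne) fun x => norm_ne_zero_iff.2 (hne x)).smul hv)
    (fun x => by
      have := norm_ne_zero_iff.2 (hne x)
      rw [norm_smul, norm_div, norm_norm, Real.norm_of_nonneg hR.le]
      field_simp)
  refine hrx ?_
  simp only [hfix x hx, hx, div_self hR.ne', one_smul]

open Metric in
theorem exists_eq_zero_of_eq_self_of_le_norm {E : Type*} [NormedAddCommGroup E]
    [InnerProductSpace ℝ E] [FiniteDimensional ℝ E] {w : E → E} {R : ℝ} (hR : 0 < R)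
    (hw : Continuous w) (hfix : ∀ x, R ≤ ‖x‖ → w x = x) : ∃ x, w x = 0 := by
  by_contra! hne
  obtain ⟨δ, hδ, hδw⟩ : ∃ δ > 0, ∀ x, δ ≤ ‖w x‖ := by
    obtain ⟨x, -, hx⟩ := (isCompact_closedBall (0 : E) R).exists_isMinOn
      ⟨0, by simpa using hR.le⟩ hw.norm.continuousOn
    refine ⟨min R ‖w x‖, lt_min hR (norm_pos_iff.2 (hne x)), fun y => ?_⟩
    rcases le_total R ‖y‖ with hy | hy
    · rw [hfix y hy]; exact (min_le_left _ _).trans hy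
    · exact (min_le_right _ _).trans (hx (by simpa using hy))
  have hsupp : HasCompactSupport fun x => w x - x :=
    HasCompactSupport.intro (isCompact_closedBall (0 : E) R) fun x hx => by
      rw [hfix x (by simpa using (not_le.1 (mt mem_closedBall_zero_iff.2 hx)).le), sub_self]
  have huc : UniformContinuous w := by
    simpa using (hsupp.uniformContinuous_of_continuous (hw.sub continuous_id)).add
      uniformContinuous_id
  obtain ⟨p, hp, hpw⟩ := huc.exists_contDiff_dist_le hδ
  let χ : ContDiffBump (0 : E) := ⟨R, R + 1, hR, by linarith⟩
  obtain ⟨x, hx⟩ := exists_eq_zero_of_contDiff (v := fun x => x + χ x • (p x - x))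
    (R := R + 1) (by linarith)
    (contDiff_id.add (χ.contDiff.smul ((hp.of_le (by simp)).sub contDiff_id)))
    (fun x hx => by rw [χ.zero_of_le_dist (by simp [hx, χ]), zero_smul, add_zero])
  have hxw : x + χ x • (p x - x) - w x = χ x • (p x - w x) := by
    rcases le_total R ‖x‖ with hy | hy
    · rw [hfix x hy]; abel
    · rw [χ.one_of_mem_closedBall (by simpa using hy)]; simp
  rw [hx, zero_sub] at hxw
  have h1 := hδw x
  rw [← norm_neg, hxw, norm_smul, Real.norm_of_nonneg χ.nonneg, ← dist_eq_norm] at h1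
  have := mul_le_of_le_one_left (dist_nonneg (x := p x) (y := w x)) (χ.le_one (x := x))
  linarith [hpw x]

/-- A continuous self-map that agrees with the identity off a compact set has a zero. -/
theorem exists_eq_zero_of_hasCompactSupport_sub {E : Type*} [NormedAddCommGroup E]
    [NormedSpace ℝ E] [FiniteDimensional ℝ E] {w : E → E}
    (hw : Continuous w) (hsupp : HasCompactSupport fun x => w x - x) : ∃ x, w x = 0 := by
  let e := toEuclidean (E := E)
  obtain ⟨R, hR⟩ := (hsupp.isCompact.image e.continuous).isBounded.exists_norm_le
  obtain ⟨y, hy⟩ := exists_eq_zero_of_eq_self_of_le_norm (w := fun y => e (w (e.symm y)))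
    (R := max R 0 + 1) (by positivity) (by fun_prop) (fun y hy => by
      have h0 : e.symm y ∉ tsupport fun x => w x - x := fun hmem => by
        have := hR _ (mem_image_of_mem e hmem)
        rw [e.apply_symm_apply] at this
        linarith [le_max_left R 0]
      have h1 : w (e.symm y) = e.symm y :=
        sub_eq_zero.1 (image_eq_zero_of_notMem_tsupport (f := fun x => w x - x) h0)
      rw [h1, e.apply_symm_apply])
  exact ⟨e.symm y, by simpa using hy⟩

open Metric in
theorem exists_zero_and_eq_clamp {E : Type*} [NormedAddCommGroup E] [InnerProductSpace ℝ E]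
    [FiniteDimensional ℝ E] {H : E × ℝ → E} (hH : Continuous H) {X : Set E} (hX : IsCompact X)
    {x₀ : E} (hx₀ : x₀ ∈ X) (hpos : ∀ x ∉ X, ∀ s, 0 < ⟪x - x₀, H (x, s)⟫)
    {γ : E × ℝ → ℝ} (hγ : Continuous γ) :
    ∃ z ∈ X ×ˢ Icc (0 : ℝ) 1, H z = 0 ∧ z.2 = max 0 (min 1 (z.2 - γ z)) := by
  set c : E × ℝ → ℝ := fun z => max 0 (min 1 (z.2 - γ z)) with hc
  have hc0 : ∀ z, 0 ≤ c z := fun z => le_max_left _ _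
  have hc1 : ∀ z, c z ≤ 1 := fun z => max_le zero_le_one (min_le_left _ _)
  have hcc : Continuous c := by fun_prop
  set z₀ : E × ℝ := (x₀, 1 / 2)
  obtain ⟨R, hR⟩ := (hX.prod (isCompact_Icc (a := (0 : ℝ)) (b := 1))).isBounded.subset_closedBall z₀
  set m : E × ℝ → ℝ := fun z => min 1 (max 0 (‖z - z₀‖ - R)) with hm
  have hm0 : ∀ z, 0 ≤ m z := fun z => le_min zero_le_one (le_max_left _ _)
  have hm1 : ∀ z, m z ≤ 1 := fun z => min_le_left _ _
  have hmc : Continuous m := by fun_prop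
  set W : E × ℝ → E × ℝ := fun z => (1 - m z) • (H z, z.2 - c z) + m z • (z - z₀) with hW
  have hWc : Continuous W := by fun_prop
  obtain ⟨y, hy⟩ := exists_eq_zero_of_hasCompactSupport_sub (w := fun y => W (y + z₀))
    (by fun_prop) (HasCompactSupport.intro (isCompact_closedBall 0 (R + 1)) fun y hy => by
      have hy' : R + 1 < ‖y‖ := not_le.1 (mt mem_closedBall_zero_iff.2 hy)
      have : m (y + z₀) = 1 := by
        rw [hm]
        simp only [add_sub_cancel_right]
        exact min_eq_left (le_max_of_le_right (by linarith))
      simp [hW, this])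
  set z := y + z₀
  have hy1 : (1 - m z) • H z + m z • (z.1 - x₀) = 0 := congrArg Prod.fst hy
  have hy2 : (1 - m z) * (z.2 - c z) + m z * (z.2 - 1 / 2) = 0 := congrArg Prod.snd hy
  have hpos' : ∀ a b : ℝ, 0 < a → 0 < b → (1 - m z) * a + m z * b ≠ 0 := by
    intro a b ha hb
    rcases (hm0 z).eq_or_lt with h | h
    · simpa [← h] using ha.ne'
    · exact (add_pos_of_nonneg_of_pos (mul_nonneg (sub_nonneg.2 (hm1 z)) ha.le)
        (mul_pos h hb)).ne'
  have hz1 : z.1 ∈ X := by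
    by_contra hzX
    have h := congrArg (fun v => ⟪z.1 - x₀, v⟫) hy1
    simp only [inner_add_right, inner_smul_right, inner_zero_right] at h
    refine hpos' _ _ (hpos z.1 hzX z.2) ?_ h
    rw [real_inner_self_pos]
    exact sub_ne_zero.2 fun h => hzX (h ▸ hx₀)
  have hz20 : 0 ≤ z.2 := by
    by_contra! h
    exact hpos' (-(z.2 - c z)) (-(z.2 - 1 / 2)) (by linarith [hc0 z]) (by linarith) (by linarith)
  have hz21 : z.2 ≤ 1 := by
    by_contra! h
    exact hpos' (z.2 - c z) (z.2 - 1 / 2) (by linarith [hc1 z]) (by linarith) (by linarith)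
  have hzK : z ∈ X ×ˢ Icc (0 : ℝ) 1 := ⟨hz1, hz20, hz21⟩
  have hmz : m z = 0 := by
    have := mem_closedBall_iff_norm.1 (hR hzK)
    rw [hm]
    simp only
    rw [max_eq_left (by linarith), min_eq_right zero_le_one]
  rw [hmz] at hy1 hy2
  exact ⟨z, hzK, by simpa using hy1, by simpa [sub_eq_zero] using hy2⟩

theorem exists_isClopen_disjoint_of_disjoint_connectedComponent {Z : Type*} [TopologicalSpace Z]
    [T2Space Z] [CompactSpace Z] {z : Z} {T : Set Z} (hT : IsClosed T)
    (hd : Disjoint (connectedComponent z) T) : ∃ U, IsClopen U ∧ z ∈ U ∧ Disjoint U T := by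
  rw [connectedComponent_eq_iInter_isClopen, disjoint_iff_inter_eq_empty, inter_comm] at hd
  have : Nonempty { s : Set Z // IsClopen s ∧ z ∈ s } := ⟨⟨univ, isClopen_univ, mem_univ z⟩⟩
  obtain ⟨U, hU⟩ := hT.isCompact.elim_directed_family_closed
    (fun s : { s : Set Z // IsClopen s ∧ z ∈ s } => s.1) (fun s => s.2.1.1) hd
    (fun s t => ⟨⟨s.1 ∩ t.1, s.2.1.inter t.2.1, s.2.2, t.2.2⟩, inter_subset_left,
      inter_subset_right⟩)
  exact ⟨U.1, U.2.1, U.2.2, by rwa [disjoint_iff_inter_eq_empty, inter_comm]⟩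

/-- A homotopy to `x ↦ x - x₀` that points outward off a compact set `X` has a connected set of
zeros joining the two ends. -/
theorem exists_isConnected_zeros {E : Type*} [NormedAddCommGroup E] [InnerProductSpace ℝ E]
    [FiniteDimensional ℝ E] {H : E × ℝ → E} (hH : Continuous H) {X : Set E} (hX : IsCompact X)
    {x₀ : E} (hx₀ : x₀ ∈ X) (hpos : ∀ x ∉ X, ∀ s, 0 < ⟪x - x₀, H (x, s)⟫)
    (hH1 : ∀ x, H (x, 1) = x - x₀) :
    ∃ C ⊆ {p : E × ℝ | p ∈ X ×ˢ Icc (0 : ℝ) 1 ∧ H p = 0}, IsConnected C ∧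
      (C ∩ X ×ˢ ({0} : Set ℝ)).Nonempty ∧ (C ∩ X ×ˢ ({1} : Set ℝ)).Nonempty := by
  set Z := {p : E × ℝ | p ∈ X ×ˢ Icc (0 : ℝ) 1 ∧ H p = 0}
  have hZ : IsCompact Z :=
    (hX.prod isCompact_Icc).inter_right (isClosed_singleton.preimage hH)
  have : CompactSpace Z := isCompact_iff_compactSpace.1 hZ
  set z₁ : Z := ⟨(x₀, 1), ⟨hx₀, zero_le_one, le_rfl⟩, by rw [hH1, sub_self]⟩
  refine ⟨Subtype.val '' connectedComponent z₁, Subtype.coe_image_subset _ _,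
    isConnected_connectedComponent.image _ continuous_subtype_val.continuousOn, ?_,
    ⟨_, mem_image_of_mem _ mem_connectedComponent, hx₀, rfl⟩⟩
  by_contra hne
  obtain ⟨U, hU, hzU, hUT⟩ := exists_isClopen_disjoint_of_disjoint_connectedComponent
    (z := z₁) (T := {z : Z | z.1.2 = 0})
    (isClosed_singleton.preimage (continuous_snd.comp continuous_subtype_val)) (by
      rw [Set.disjoint_left]
      exact fun z hz h0 => hne ⟨z.1, mem_image_of_mem _ hz, z.2.1.1, h0⟩)
  have hcl : ∀ V : Set Z, IsClosed V → IsClosed (Subtype.val '' V) := fun V hV =>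
    (hV.isCompact.image continuous_subtype_val).isClosed
  obtain ⟨φ, hφ0, hφ1, -⟩ := exists_continuous_zero_one_of_isClosed (hcl U hU.1)
    (hcl Uᶜ hU.compl.1) ((disjoint_image_iff Subtype.val_injective).2 disjoint_compl_right)
  obtain ⟨z, hzK, hz0, hz⟩ := exists_zero_and_eq_clamp hH hX hx₀ hpos
    (γ := fun z => 1 - 2 * φ z) (by fun_prop)
  have h0 := hzK.2.1
  have h1 := hzK.2.2
  have hzZ : z ∈ Z := ⟨hzK, hz0⟩
  by_cases hmem : (⟨z, hzZ⟩ : Z) ∈ U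
  · have hφ : φ z = 0 := hφ0 (mem_image_of_mem Subtype.val hmem)
    refine Set.disjoint_left.1 hUT hmem (show z.2 = 0 from ?_)
    rw [hφ, min_eq_right (by linarith), max_eq_left (by linarith)] at hz
    exact hz
  · have hφ : φ z = 1 := hφ1 (mem_image_of_mem Subtype.val (show _ ∈ Uᶜ from hmem))
    rw [hφ, min_eq_left (by linarith), max_eq_right zero_le_one] at hz
    obtain ⟨x, s⟩ := z
    obtain rfl : s = 1 := hz
    rw [hH1, sub_eq_zero] at hz0
    subst hz0
    exact hmem hzU

theorem exists_mem_Icc_succ_of_mem_Icc {t : ℕ → ℝ} {L : ℕ} (hL : 0 < L) {s : ℝ}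
    (hs : s ∈ Icc (t L) (t 0)) :
    ∃ ℓ < L, s ∈ Icc (t (ℓ + 1)) (t ℓ) := by
  by_contra! h
  have hlt : ∀ k ≤ L, k ≠ 0 → s < t k := by
    intro k
    induction k with
    | zero => simp
    | succ k ih =>
      intro hk _
      by_contra! hle
      refine h k hk ⟨hle, ?_⟩
      rcases eq_or_ne k 0 with rfl | hk0
      · exact hs.2
      · exact (ih (by omega) hk0).le
  exact (hlt L le_rfl hL.ne').not_ge hs.1

theorem continuousOn_univ_prod_Icc_of_forall_lt {E F : Type*} [TopologicalSpace E]
    [TopologicalSpace F] {t : ℕ → ℝ} {L : ℕ} (hL : 0 < L)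
    {D : E × ℝ → F} (hD : ∀ ℓ < L, ContinuousOn D (univ ×ˢ Icc (t (ℓ + 1)) (t ℓ))) :
    ContinuousOn D (univ ×ˢ Icc (t L) (t 0)) := by
  have h := (locallyFinite_of_finite
    fun ℓ : Fin L => (univ : Set E) ×ˢ Icc (t (ℓ + 1)) (t ℓ)).continuousOn_iUnion
      (fun ℓ => isClosed_univ.prod isClosed_Icc) (fun ℓ => hD ℓ ℓ.2)
  refine h.mono fun z hz => mem_iUnion.2 ?_
  obtain ⟨ℓ, hℓ, hzℓ⟩ := exists_mem_Icc_succ_of_mem_Icc hL hz.2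
  exact ⟨⟨ℓ, hℓ⟩, mem_univ _, hzℓ⟩

/-- Corollary 3: Under Assumption 1, the solution set
H⁻¹ = {(x,t) ∈ X × [0,1] : h(x,t) = 0} contains a connected subset H_c⁻¹ meeting both
X × {0} and X × {1}. -/
theorem stmt_7
    (n N L : ℕ) (hn : 0 < n) (hN : 0 < N) (hL : 0 < L) (hLN : L ≤ N)
    (f : ℕ → EuclideanSpace ℝ (Fin n) → EuclideanSpace ℝ (Fin n))
    (hf : ∀ i < N, ContDiff ℝ 1 (f i))
    (q : ℕ → ℕ) (hq0 : q 0 = 0) (hqL : q L = N)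
    (hqmono : ∀ ℓ < L, q ℓ < q (ℓ + 1))
    (F : ℕ → EuclideanSpace ℝ (Fin n) → EuclideanSpace ℝ (Fin n))
    (hF0 : ∀ x, F 0 x = 0)
    (hF : ∀ ℓ, 1 ≤ ℓ → ℓ ≤ L → ∀ x,
      F ℓ x = (q ℓ : ℝ)⁻¹ • ∑ i ∈ Finset.range (q ℓ), f i x)
    (t : ℕ → ℝ) (ht0 : t 0 = 1) (htL : t L = 0)
    (htmono : ∀ ℓ < L, t (ℓ + 1) < t ℓ)
    (θ : ℕ → ℝ → ℝ)
    (hθ : ∀ ℓ s, θ ℓ s = Real.sin (π / 2 * ((s - t (ℓ - 1)) / (t ℓ - t (ℓ - 1)))) ^ 2)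
    (d : EuclideanSpace ℝ (Fin n) → ℝ → EuclideanSpace ℝ (Fin n))
    (hd : ∀ ℓ, 1 ≤ ℓ → ℓ ≤ L → ∀ s ∈ Icc (t ℓ) (t (ℓ - 1)), ∀ x,
      d x s = (1 - θ ℓ s) • F (ℓ - 1) x + θ ℓ s • F ℓ x)
    (x0 : EuclideanSpace ℝ (Fin n))
    (h : EuclideanSpace ℝ (Fin n) → ℝ → EuclideanSpace ℝ (Fin n))
    (hh : ∀ x s, h x s = (1 - s) • d x s + s • (x - x0))
    (X : Set (EuclideanSpace ℝ (Fin n))) (hXc : IsCompact X) (hXconv : Convex ℝ X)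
    (hXint : (interior X).Nonempty) (hx0 : x0 ∈ interior X)
    (ha1 : ∀ i < N, ∀ x ∉ interior X, 0 < ⟪x - x0, f i x⟫)
    :
    ∃ Hc ⊆ {p : EuclideanSpace ℝ (Fin n) × ℝ | p ∈ X ×ˢ Icc (0 : ℝ) 1 ∧ h p.1 p.2 = 0},
      IsConnected Hc ∧
      (Hc ∩ X ×ˢ ({0} : Set ℝ)).Nonempty ∧
      (Hc ∩ X ×ˢ ({1} : Set ℝ)).Nonempty := by
  have hqle : ∀ j ℓ, ℓ + j ≤ L → q ℓ ≤ q (ℓ + j) := by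
    intro j
    induction j with
    | zero => intro ℓ _; exact le_rfl
    | succ j ih =>
      intro ℓ hℓ
      exact (ih ℓ (by omega)).trans (hqmono (ℓ + j) (by omega)).le
  have hqN : ∀ ℓ ≤ L, q ℓ ≤ N := fun ℓ hℓ => by
    have := hqle (L - ℓ) ℓ (by omega)
    rwa [Nat.add_sub_cancel' hℓ, hqL] at this
  have hFc : ∀ ℓ ≤ L, Continuous (F ℓ) := by
    intro ℓ hℓ
    rcases Nat.eq_zero_or_pos ℓ with rfl | hℓ0
    · rw [show F 0 = fun _ => 0 from funext hF0]
      exact continuous_const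
    · have hsum : Continuous fun x => ∑ i ∈ Finset.range (q ℓ), f i x :=
        continuous_finsetSum _ fun i hi =>
          (hf i ((Finset.mem_range.1 hi).trans_le (hqN ℓ hℓ))).continuous
      exact (hsum.const_smul (q ℓ : ℝ)⁻¹).congr fun x => (hF ℓ hℓ0 hℓ x).symm
  have hFpos : ∀ ℓ < L, ∀ x ∉ interior X, 0 < ⟪x - x0, F (ℓ + 1) x⟫ := by
    intro ℓ hℓ x hx
    have hq : 0 < q (ℓ + 1) := (Nat.zero_le _).trans_lt (hqmono ℓ hℓ)
    rw [hF (ℓ + 1) (by omega) hℓ, inner_smul_right, inner_sum]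
    exact mul_pos (by positivity) (Finset.sum_pos
      (fun i hi => ha1 i ((Finset.mem_range.1 hi).trans_le (hqN _ hℓ)) x hx) ⟨0, by simpa using hq⟩)
  have hFnonneg : ∀ ℓ ≤ L, ∀ x ∉ interior X, 0 ≤ ⟪x - x0, F ℓ x⟫ := by
    intro ℓ hℓ x hx
    cases ℓ with
    | zero => rw [hF0, inner_zero_right]
    | succ ℓ => exact (hFpos ℓ hℓ x hx).le
  have hdeq : ∀ ℓ < L, ∀ s ∈ Icc (t (ℓ + 1)) (t ℓ), ∀ x,
      d x s = (1 - θ (ℓ + 1) s) • F ℓ x + θ (ℓ + 1) s • F (ℓ + 1) x := fun ℓ hℓ =>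
    hd (ℓ + 1) (by omega) hℓ
  have hθc : ∀ ℓ, Continuous (θ ℓ) := fun ℓ => by
    rw [show θ ℓ = _ from funext (hθ ℓ)]
    fun_prop
  have hdc : ContinuousOn (fun z : EuclideanSpace ℝ (Fin n) × ℝ => d z.1 z.2)
      (univ ×ˢ Icc 0 1) := by
    rw [← htL, ← ht0]
    refine continuousOn_univ_prod_Icc_of_forall_lt hL fun ℓ hℓ => ?_
    have h0 := hFc ℓ hℓ.le
    have h1 := hFc (ℓ + 1) hℓ
    have h2 := hθc (ℓ + 1)
    refine ContinuousOn.congr (Continuous.continuousOn ?_) fun z hz => hdeq ℓ hℓ z.2 hz.2 z.1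
    fun_prop
  have hhc : ContinuousOn (fun z : EuclideanSpace ℝ (Fin n) × ℝ => h z.1 z.2)
      (univ ×ˢ Icc 0 1) := by
    simp only [hh]
    fun_prop
  have hdnonneg : ∀ s ∈ Icc (0 : ℝ) 1, ∀ x ∉ interior X, 0 ≤ ⟪x - x0, d x s⟫ := by
    intro s hs x hx
    rw [← htL, ← ht0] at hs
    obtain ⟨ℓ, hℓ, hsℓ⟩ := exists_mem_Icc_succ_of_mem_Icc hL hs
    have hθ0 : 0 ≤ θ (ℓ + 1) s := by rw [hθ]; positivity
    have hθ1 : θ (ℓ + 1) s ≤ 1 := by rw [hθ]; exact sin_sq_le_one _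
    rw [hdeq ℓ hℓ s hsℓ, inner_add_right, inner_smul_right, inner_smul_right]
    exact add_nonneg (mul_nonneg (sub_nonneg.2 hθ1) (hFnonneg ℓ hℓ.le x hx))
      (mul_nonneg hθ0 (hFnonneg (ℓ + 1) hℓ x hx))
  have hd0 : ∀ x ∉ interior X, 0 < ⟪x - x0, d x 0⟫ := by
    intro x hx
    obtain ⟨ℓ, rfl⟩ : ∃ ℓ, L = ℓ + 1 := ⟨L - 1, by omega⟩
    have hlt := htmono ℓ (by omega)
    have hθ1 : θ (ℓ + 1) 0 = 1 := by
      rw [hθ, htL, Nat.add_sub_cancel, div_self (by rw [htL] at hlt; linarith), mul_one,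
        sin_pi_div_two, one_pow]
    rw [hdeq ℓ (by omega) 0 ⟨htL.le, htL ▸ hlt.le⟩, hθ1, sub_self, zero_smul, zero_add, one_smul]
    exact hFpos ℓ (by omega) x hx
  have hpos : ∀ x ∉ interior X, ∀ s ∈ Icc (0 : ℝ) 1, 0 < ⟪x - x0, h x s⟫ := by
    intro x hx s hs
    rw [hh, inner_add_right, inner_smul_right, inner_smul_right]
    rcases hs.1.eq_or_lt with rfl | hs0
    · simpa using hd0 x hx
    · refine add_pos_of_nonneg_of_pos
        (mul_nonneg (sub_nonneg.2 hs.2) (hdnonneg s hs x hx)) (mul_pos hs0 ?_)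
      rw [real_inner_self_pos]
      exact sub_ne_zero.2 fun hxx => hx (hxx ▸ hx0)
  have hproj : ∀ s : ℝ, (projIcc 0 1 zero_le_one s : ℝ) ∈ Icc (0 : ℝ) 1 := fun s => Subtype.prop _
  obtain ⟨C, hC, hconn, hC0, hC1⟩ := exists_isConnected_zeros
    (H := fun z : EuclideanSpace ℝ (Fin n) × ℝ => h z.1 (projIcc 0 1 zero_le_one z.2))
    (hhc.comp_continuous (f := fun z : EuclideanSpace ℝ (Fin n) × ℝ =>
        (z.1, (projIcc (0 : ℝ) 1 zero_le_one z.2 : ℝ)))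
      (continuous_fst.prodMk (continuous_subtype_val.comp (continuous_projIcc.comp continuous_snd)))
      fun z => ⟨mem_univ z.1, hproj z.2⟩)
    hXc (interior_subset hx0)
    (fun x hx s => hpos x (fun hxi => hx (interior_subset hxi)) _ (hproj s))
    (fun x => by simp [hh])
  refine ⟨C, fun z hz => ⟨(hC hz).1, ?_⟩, hconn, hC0, hC1⟩
  have h0 := (hC hz).2
  rwa [projIcc_of_mem _ (hC hz).1.2] at h0
end
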